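/- arXiv:0802.4195 — 2 statements merged into one kernel-verified Lean document; each statement's English description precedes it below -/
import Mathlib

section
/- Let N ≥ 1, let A, C ∈ ℂ^{N×N}, and let U : [0,∞) → ℂ^{N×N} be a differentiable curve with U(0) ∈ SU(N) satisfying the gradient system U'(t) = −([U(t) A U(t)†, C†])_S · U(t) for all t ≥ 0. Then U(t) ∈ SU(N) for all t ≥ 0, the function t ↦ Re tr(C† U(t) A U(t)†) is nondecreasing, and U(t) converges as t → +∞ to a matrix U∞ ∈ SU(N) satisfying ([U∞ A U∞†, C†])_S = 0, i.e. to a critical point of f₁(U) = Re tr(C† U A U†) on SU(N). -/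
open Matrix Filter Topology

attribute [local instance] Matrix.normedAddCommGroup Matrix.normedSpace

/-- The skew-Hermitian part `M_S = (M − M†)/2` of a square complex matrix. -/
noncomputable def skewPart {N : ℕ} (M : Matrix (Fin N) (Fin N) ℂ) :
    Matrix (Fin N) (Fin N) ℂ :=
  ((1 : ℂ) / 2) • (M - Mᴴ)

section Elimination

open Polynomial

variable {σ : Type*} [Fintype σ]

/-- Real functions of `(s, y)` that are polynomial, of degree at most `k` in `y` and at most `j`
in `s`. -/
def polyFun (σ : Type*) [Fintype σ] (k j : ℕ) : Submodule ℝ (ℝ × (σ → ℝ) → ℝ) :=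
  Submodule.span ℝ {F | ∃ (a : ℕ) (β : σ → ℕ), a ≤ j ∧ ∑ i, β i ≤ k ∧
    F = fun z => z.1 ^ a * ∏ i, z.2 i ^ β i}

theorem monomial_mem_polyFun {k j a : ℕ} {β : σ → ℕ} (ha : a ≤ j) (hβ : ∑ i, β i ≤ k) :
    (fun z : ℝ × (σ → ℝ) => z.1 ^ a * ∏ i, z.2 i ^ β i) ∈ polyFun σ k j :=
  Submodule.subset_span ⟨a, β, ha, hβ, rfl⟩

theorem polyFun_mono {k j k' j' : ℕ} (hk : k ≤ k') (hj : j ≤ j') :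
    polyFun σ k j ≤ polyFun σ k' j' := by
  apply Submodule.span_mono
  rintro F ⟨a, β, ha, hβ, rfl⟩
  exact ⟨a, β, ha.trans hj, hβ.trans hk, rfl⟩

theorem mul_mem_polyFun {k j k' j' : ℕ} {F G : ℝ × (σ → ℝ) → ℝ} (hF : F ∈ polyFun σ k j)
    (hG : G ∈ polyFun σ k' j') : F * G ∈ polyFun σ (k + k') (j + j') := by
  have h := Submodule.mul_mem_mul hF hG
  rw [polyFun, polyFun, Submodule.span_mul_span] at h
  refine Submodule.span_mono ?_ h
  rintro _ ⟨_, ⟨a, β, ha, hβ, rfl⟩, _, ⟨a', β', ha', hβ', rfl⟩, rfl⟩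
  refine ⟨a + a', fun i => β i + β' i, by omega, ?_, ?_⟩
  · rw [Finset.sum_add_distrib]; omega
  · funext z
    simp only [Pi.mul_apply, pow_add, Finset.prod_mul_distrib]
    ring

theorem eval_mem_polyFun {k : ℕ} (P : MvPolynomial σ ℝ) (hP : P.totalDegree ≤ k) :
    (fun z : ℝ × (σ → ℝ) => MvPolynomial.eval z.2 P) ∈ polyFun σ k 0 := by
  have h : (fun z : ℝ × (σ → ℝ) => MvPolynomial.eval z.2 P)
      = ∑ d ∈ P.support, P.coeff d • fun z : ℝ × (σ → ℝ) => z.1 ^ 0 * ∏ i, z.2 i ^ d i := by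
    funext z
    simp [MvPolynomial.eval_eq', Finset.sum_apply]
  rw [h]
  refine Submodule.sum_mem _ fun d hd => Submodule.smul_mem _ _ (monomial_mem_polyFun le_rfl ?_)
  refine le_trans (le_of_eq ?_) ((MvPolynomial.le_totalDegree hd).trans hP)
  rw [Finsupp.sum_fintype _ _ (fun _ => rfl)]

theorem eval_fst_mem_polyFun {j : ℕ} (c : ℝ[X]) (hc : c.natDegree ≤ j) :
    (fun z : ℝ × (σ → ℝ) => c.eval z.1) ∈ polyFun σ 0 j := by
  have h : (fun z : ℝ × (σ → ℝ) => c.eval z.1)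
      = ∑ a ∈ Finset.range (c.natDegree + 1),
        c.coeff a • fun z : ℝ × (σ → ℝ) => z.1 ^ a * ∏ i, z.2 i ^ (0 : σ → ℕ) i := by
    funext z
    simp [eval_eq_sum_range, Finset.sum_apply]
  rw [h]
  refine Submodule.sum_mem _ fun a ha => Submodule.smul_mem _ _ (monomial_mem_polyFun ?_ (by simp))
  have := Finset.mem_range.1 ha
  omega

/-- On `S`, the function `F` is a combination of the monomials with all exponents below `e`, with
coefficients polynomial in `s` of degree at most `j`. -/
def IsReducedOn [DecidableEq σ] (S : Set (ℝ × (σ → ℝ))) (e j : ℕ) (F : ℝ × (σ → ℝ) → ℝ) : Prop :=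
  ∃ c : (σ → Fin e) → ℝ[X], (∀ α, (c α).natDegree ≤ j) ∧
    ∀ z ∈ S, F z = ∑ α, (c α).eval z.1 * ∏ i, z.2 i ^ (α i : ℕ)

theorem isReduced_of_mem_span [DecidableEq σ] {S : Set (ℝ × (σ → ℝ))} {e j : ℕ}
    {A : Set (ℝ × (σ → ℝ) → ℝ)}
    (hA : ∀ F ∈ A, IsReducedOn S e j F) {F : ℝ × (σ → ℝ) → ℝ} (hF : F ∈ Submodule.span ℝ A) :
    IsReducedOn S e j F := by
  induction hF using Submodule.span_induction with
  | mem F hF => exact hA F hF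
  | zero => exact ⟨0, by simp, by simp⟩
  | add F G _ _ hF hG =>
    obtain ⟨c, hc, hc'⟩ := hF
    obtain ⟨d, hd, hd'⟩ := hG
    refine ⟨c + d, fun α => (natDegree_add_le _ _).trans (max_le (hc α) (hd α)), fun z hz => ?_⟩
    simp [hc' z hz, hd' z hz, add_mul, Finset.sum_add_distrib]
  | smul r F _ hF =>
    obtain ⟨c, hc, hc'⟩ := hF
    refine ⟨fun α => C r * c α, fun α => (natDegree_C_mul_le _ _).trans (hc α), fun z hz => ?_⟩
    simp [hc' z hz, Finset.mul_sum, mul_assoc]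

theorem isReduced_of_mem_polyFun [DecidableEq σ] {S : Set (ℝ × (σ → ℝ))} {e κ : ℕ} (he : 0 < e)
    {p : σ → ℝ × (σ → ℝ) → ℝ} (hp : ∀ i, p i ∈ polyFun σ (e - 1) κ)
    (hS : ∀ z ∈ S, ∀ i, z.2 i ^ e = p i z) (k : ℕ) :
    ∀ (j : ℕ) (F : ℝ × (σ → ℝ) → ℝ), F ∈ polyFun σ k j → IsReducedOn S e (j + κ * k) F := by
  induction k using Nat.strong_induction_on with
  | _ k ih =>
    intro j F hF
    refine isReduced_of_mem_span ?_ hF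
    rintro _ ⟨a, β, ha, hβ, rfl⟩
    by_cases hlt : ∀ i, β i < e
    · refine ⟨Pi.single (fun i => ⟨β i, hlt i⟩) (X ^ a), fun α => ?_, fun z _ => ?_⟩
      · by_cases h : α = fun i => ⟨β i, hlt i⟩
        · subst h; simp; nlinarith
        · simp [Pi.single_eq_of_ne h]
      · rw [Finset.sum_eq_single (fun i => (⟨β i, hlt i⟩ : Fin e))]
        · simp
        · intro α _ h; simp [Pi.single_eq_of_ne h]
        · simp
    · push Not at hlt
      obtain ⟨i, hi⟩ := hlt
      have hsum : ∑ l, Function.update β i (β i - e) l + e = ∑ l, β l := by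
        rw [← Finset.add_sum_erase _ _ (Finset.mem_univ i),
          ← Finset.add_sum_erase Finset.univ β (Finset.mem_univ i)]
        have h : ∑ l ∈ Finset.univ.erase i, Function.update β i (β i - e) l
            = ∑ l ∈ Finset.univ.erase i, β l :=
          Finset.sum_congr rfl fun l hl => by simp [Finset.ne_of_mem_erase hl]
        rw [h, Function.update_self]
        omega
      have hmem := mul_mem_polyFun (monomial_mem_polyFun (β := Function.update β i (β i - e))
        ha le_rfl) (hp i)
      obtain ⟨c, hc, hc'⟩ := ih (k - 1) (by omega) (j + κ) _
        (polyFun_mono (by omega) le_rfl hmem)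
      refine ⟨c, fun α => (hc α).trans ?_, fun z hz => ?_⟩
      · obtain ⟨k, rfl⟩ : ∃ k', k = k' + 1 := ⟨k - 1, by omega⟩
        simp only [Nat.add_sub_cancel]; nlinarith
      · have h : ∏ l ∈ Finset.univ.erase i, z.2 l ^ Function.update β i (β i - e) l
            = ∏ l ∈ Finset.univ.erase i, z.2 l ^ β l :=
          Finset.prod_congr rfl fun l hl => by simp [Finset.ne_of_mem_erase hl]
        rw [← hc' z hz, Pi.mul_apply, ← hS z hz i]
        simp only []
        rw [← Finset.mul_prod_erase _ _ (Finset.mem_univ i),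
          ← Finset.mul_prod_erase Finset.univ
            (fun l => z.2 l ^ Function.update β i (β i - e) l) (Finset.mem_univ i), h,
          Function.update_self, ← Nat.sub_add_cancel hi, pow_add, Nat.add_sub_cancel]
        ring

/-- All coefficients of the bivariate polynomial `P` have degree at most `B`. -/
def CoeffDegLE (B : ℕ) (P : ℝ[X][X]) : Prop := ∀ k, (P.coeff k).natDegree ≤ B

theorem CoeffDegLE.mul {B B' : ℕ} {P Q : ℝ[X][X]} (hP : CoeffDegLE B P) (hQ : CoeffDegLE B' Q) :
    CoeffDegLE (B + B') (P * Q) := by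
  intro k
  rw [coeff_mul]
  exact natDegree_sum_le_of_forall_le _ _ fun x _ =>
    natDegree_mul_le.trans (add_le_add (hP _) (hQ _))

theorem CoeffDegLE.prod {ι : Type*} (t : Finset ι) {B : ℕ} {P : ι → ℝ[X][X]}
    (hP : ∀ i, CoeffDegLE B (P i)) : CoeffDegLE (t.card * B) (∏ i ∈ t, P i) := by
  classical
  induction t using Finset.induction_on with
  | empty => intro k; simp [coeff_one]; split_ifs <;> simp
  | insert a t ha ih =>
    rw [Finset.prod_insert ha, Finset.card_insert_of_notMem ha, add_mul, one_mul, add_comm]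
    exact (hP a).mul ih

theorem CoeffDegLE.eval {B : ℕ} {P : ℝ[X][X]} (hP : CoeffDegLE B P) (a : ℝ) :
    (P.eval (C a)).natDegree ≤ B := by
  rw [eval_eq_sum_range]
  refine natDegree_sum_le_of_forall_le _ _ fun k _ => ?_
  rw [← C_pow]
  exact (natDegree_mul_C_le _ _).trans (hP k)

theorem coeffDegLE_charpoly {ι : Type*} [Fintype ι] [DecidableEq ι] {B : ℕ} (A : Matrix ι ι ℝ[X])
    (hA : ∀ a b, (A a b).natDegree ≤ B) : CoeffDegLE (Fintype.card ι * B) A.charpoly := by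
  intro k
  rw [Matrix.charpoly, Matrix.det_apply, finsetSum_coeff]
  refine natDegree_sum_le_of_forall_le _ _ fun τ _ => ?_
  have h : CoeffDegLE (Fintype.card ι * B) (∏ i, A.charmatrix (τ i) i) := by
    refine CoeffDegLE.prod Finset.univ fun i l => ?_
    by_cases hi : τ i = i
    · rw [hi, Matrix.charmatrix_apply_eq, coeff_sub, coeff_X, coeff_C]
      refine (natDegree_sub_le _ _).trans (max_le ?_ ?_)
      · split_ifs <;> simp
      · split_ifs
        · exact hA _ _
        · simp
    · rw [Matrix.charmatrix_apply_ne _ _ _ hi, coeff_neg, coeff_C, natDegree_neg]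
      split_ifs
      · exact hA _ _
      · simp
  rw [coeff_smul]
  rcases Int.units_eq_one_or (Equiv.Perm.sign τ) with h1 | h1 <;> rw [h1]
  · simpa using h k
  · simpa using h k

/-- Elimination: on the solutions of `y i ^ e = p i (s, y)` with `deg p i < e`, every polynomial
function is a root of a monic polynomial whose coefficients are polynomials in `s` of degree
bounded only in terms of the degrees of the data. -/
theorem exists_monic_annihilator [DecidableEq σ] {S : Set (ℝ × (σ → ℝ))} {e κ k j : ℕ} (he : 0 < e)
    {p : σ → ℝ × (σ → ℝ) → ℝ} (hp : ∀ i, p i ∈ polyFun σ (e - 1) κ)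
    (hS : ∀ z ∈ S, ∀ i, z.2 i ^ e = p i z) {q : ℝ × (σ → ℝ) → ℝ} (hq : q ∈ polyFun σ k j) :
    ∃ Q : ℝ[X][X], Q.Monic ∧ Q.natDegree = e ^ Fintype.card σ ∧
      CoeffDegLE (e ^ Fintype.card σ * (j + κ * (k + Fintype.card σ * (e - 1)))) Q ∧
      ∀ z ∈ S, (Q.map (evalRingHom z.1)).eval (q z) = 0 := by
  have hred : ∀ α : σ → Fin e, IsReducedOn S e (j + κ * (k + Fintype.card σ * (e - 1)))
      (q * fun z => z.1 ^ 0 * ∏ i, z.2 i ^ (α i : ℕ)) := by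
    intro α
    have hα : ∑ i, (α i : ℕ) ≤ Fintype.card σ * (e - 1) := by
      refine (Finset.sum_le_card_nsmul _ _ (e - 1) fun i _ => ?_).trans (by simp)
      have := (α i).2
      omega
    have h1 : (fun z : ℝ × (σ → ℝ) => z.1 ^ 0 * ∏ i, z.2 i ^ (α i : ℕ))
        ∈ polyFun σ (Fintype.card σ * (e - 1)) 0 :=
      monomial_mem_polyFun (β := fun i => (α i : ℕ)) le_rfl hα
    have h2 := mul_mem_polyFun hq h1
    exact isReduced_of_mem_polyFun he hp hS _ _ _ h2
  choose c hc hc' using hred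
  have hcard : Fintype.card (σ → Fin e) = e ^ Fintype.card σ := by simp
  let A : Matrix (σ → Fin e) (σ → Fin e) ℝ[X] := Matrix.of c
  refine ⟨A.charpoly, A.charpoly_monic, ?_, ?_, fun z hz => ?_⟩
  · rw [Matrix.charpoly_natDegree_eq_dim, hcard]
  · have h := coeffDegLE_charpoly A hc
    rwa [hcard] at h
  · rw [← Matrix.charpoly_map, Matrix.eval_charpoly, ← Matrix.exists_mulVec_eq_zero_iff]
    refine ⟨fun α => ∏ i, z.2 i ^ (α i : ℕ), fun h => ?_, ?_⟩
    · simpa using congrFun h fun _ => ⟨0, he⟩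
    · funext α
      have := hc' α z hz
      rw [Matrix.sub_mulVec]
      simp only [Pi.mul_apply, pow_zero, one_mul] at this
      simp [Matrix.scalar_apply, this, Matrix.mulVec, dotProduct, A]

end Elimination

section Cells

open Polynomial

theorem eval_map_evalRingHom (Q : ℝ[X][X]) (s y : ℝ) :
    (Q.map (evalRingHom s)).eval y = ∑ k ∈ Finset.range (Q.natDegree + 1),
      (Q.coeff k).eval s * y ^ k := by
  rw [eval_map, eval₂_eq_sum_range]
  simp

theorem eval_map_evalRingHom_eq_eval_eval (Q : ℝ[X][X]) (s y : ℝ) :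
    (Q.map (evalRingHom s)).eval y = (Q.eval (C y)).eval s := by
  rw [eval_map_evalRingHom, eval_eq_sum_range (p := Q), eval_finsetSum]
  simp

theorem continuous_eval_map_evalRingHom (Q : ℝ[X][X]) :
    Continuous fun z : ℝ × ℝ => (Q.map (evalRingHom z.1)).eval z.2 := by
  simp only [eval_map_evalRingHom]
  fun_prop

/-- A point where a monic real polynomial of degree `D` is at most `r ^ D` in absolute value lies
within `r` of the real part of a complex root. -/
theorem exists_root_near {P : ℝ[X]} (hP : P.Monic) (hD : P.natDegree ≠ 0) {r y : ℝ} (hr : 0 < r)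
    (hy : |P.eval y| ≤ r ^ P.natDegree) :
    ∃ z ∈ (P.map (algebraMap ℝ ℂ)).roots, |y - z.re| ≤ r := by
  by_contra! hcon
  have hmon := hP.map (algebraMap ℝ ℂ)
  have hcard : Multiset.card (P.map (algebraMap ℝ ℂ)).roots = P.natDegree := by
    rw [← (IsAlgClosed.splits (P.map (algebraMap ℝ ℂ))).natDegree_eq_card_roots,
      natDegree_map]
  have hsplit := (IsAlgClosed.splits (P.map (algebraMap ℝ ℂ))).eq_prod_roots_of_monic hmon
  have heval : ((P.eval y : ℝ) : ℂ)
      = ((P.map (algebraMap ℝ ℂ)).roots.map fun z => (y : ℂ) - z).prod := by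
    have h1 : ((P.eval y : ℝ) : ℂ) = (P.map (algebraMap ℝ ℂ)).eval (y : ℂ) := by
      rw [eval_map]
      exact (eval₂_at_apply (algebraMap ℝ ℂ) y).symm
    rw [h1]
    conv_lhs => rw [hsplit]
    rw [eval_multiset_prod, Multiset.map_map]
    simp
  have hlt : ∀ M : Multiset ℂ, (∀ z ∈ M, r < |y - z.re|) → M ≠ 0 →
      r ^ Multiset.card M < ‖(M.map fun z => (y : ℂ) - z).prod‖ := by
    intro M
    induction M using Multiset.induction_on with
    | empty => intro _ h; exact absurd rfl h
    | cons a M ih =>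
      intro h _
      have ha : r < ‖(y : ℂ) - a‖ :=
        (h a (Multiset.mem_cons_self a M)).trans_le
          (by simpa using Complex.abs_re_le_norm ((y : ℂ) - a))
      rcases eq_or_ne M 0 with rfl | hM
      · simpa using ha
      · have := ih (fun z hz => h z (Multiset.mem_cons_of_mem hz)) hM
        rw [Multiset.card_cons, Multiset.map_cons, Multiset.prod_cons, norm_mul, pow_succ, mul_comm]
        exact mul_lt_mul'' ha this hr.le (by positivity)
  have h := hlt _ hcon (by rw [ne_eq, ← Multiset.card_eq_zero, hcard]; exact hD)
  rw [hcard, ← heval, Complex.norm_real, Real.norm_eq_abs] at h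
  exact absurd hy (not_le.2 h)

theorem exists_finset_near_roots {P : ℝ[X]} (hP : P.Monic) (hD : P.natDegree ≠ 0) {r : ℝ}
    (hr : 0 < r) : ∃ Z : Finset ℤ, Z.card ≤ 4 * P.natDegree ∧
      ∀ (j : ℤ) (y : ℝ), y ∈ Set.Icc (j * r) ((j + 1) * r) → |P.eval y| ≤ r ^ P.natDegree →
        j ∈ Z := by
  classical
  refine ⟨(P.map (algebraMap ℝ ℂ)).roots.toFinset.biUnion
    fun z => Finset.Icc (⌊z.re / r⌋ - 2) (⌊z.re / r⌋ + 1), ?_, fun j y hy hP' => ?_⟩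
  · refine Finset.card_biUnion_le.trans ?_
    have h4 : ∀ z : ℂ, (Finset.Icc (⌊z.re / r⌋ - 2) (⌊z.re / r⌋ + 1)).card = 4 := by
      intro z; rw [Int.card_Icc]; omega
    simp only [h4, Finset.sum_const, smul_eq_mul]
    have := (Multiset.toFinset_card_le (P.map (algebraMap ℝ ℂ)).roots).trans (card_roots' _)
    rw [natDegree_map] at this
    omega
  · obtain ⟨z, hz, hzy⟩ := exists_root_near hP hD hr hP'
    refine Finset.mem_biUnion.2 ⟨z, Multiset.mem_toFinset.2 hz, Finset.mem_Icc.2 ?_⟩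
    obtain ⟨h1, h2⟩ := abs_le.1 hzy
    obtain ⟨h3, h4⟩ := hy
    have h5 : ((j - 1 : ℤ) : ℝ) ≤ z.re / r := by
      rw [le_div_iff₀ hr]; push_cast; linarith
    have h6 : z.re / r < ((j + 3 : ℤ) : ℝ) := by
      rw [div_lt_iff₀ hr]; push_cast; linarith
    have h7 := Int.le_floor.2 h5
    have h8 := Int.floor_lt.2 h6
    omega

/-- The values of a bivariate polynomial at its critical points in the second variable are
annihilated by a monic polynomial of controlled degree. -/
theorem exists_monic_annihilator_critical {D B : ℕ} (hD : 2 ≤ D) : ∃ B' : ℕ, ∀ Q : ℝ[X][X],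
    Q.Monic → Q.natDegree = D → CoeffDegLE B Q →
    ∃ R : ℝ[X][X], R.Monic ∧ CoeffDegLE B' R ∧
      ∀ s y : ℝ, ((Q.map (evalRingHom s)).derivative).eval y = 0 →
        (R.map (evalRingHom s)).eval ((Q.map (evalRingHom s)).eval y) = 0 := by
  refine ⟨(D - 1) ^ Fintype.card (Fin 1) * (B + B * (D + Fintype.card (Fin 1) * (D - 1 - 1))),
    fun Q hQ hQD hB => ?_⟩
  have hterm : ∀ (c : ℝ[X]) (k : ℕ), c.natDegree ≤ B →
      (fun z : ℝ × (Fin 1 → ℝ) => c.eval z.1 * z.2 0 ^ k) ∈ polyFun (Fin 1) k B := by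
    intro c k hc
    have h1 : (fun z : ℝ × (Fin 1 → ℝ) => z.1 ^ 0 * ∏ i, z.2 i ^ k) ∈ polyFun (Fin 1) k 0 :=
      monomial_mem_polyFun (β := fun _ => k) le_rfl (by simp)
    have h2 := mul_mem_polyFun (eval_fst_mem_polyFun (σ := Fin 1) c hc) h1
    rw [zero_add, add_zero] at h2
    convert h2 using 1
    funext z
    simp
  have hQ' : (fun z : ℝ × (Fin 1 → ℝ) => (Q.map (evalRingHom z.1)).eval (z.2 0))
      ∈ polyFun (Fin 1) D B := by
    have : (fun z : ℝ × (Fin 1 → ℝ) => (Q.map (evalRingHom z.1)).eval (z.2 0))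
        = ∑ k ∈ Finset.range (Q.natDegree + 1),
          fun z : ℝ × (Fin 1 → ℝ) => (Q.coeff k).eval z.1 * z.2 0 ^ k := by
      funext z
      simp [eval_map_evalRingHom, Finset.sum_apply]
    rw [this]
    refine Submodule.sum_mem _ fun k hk => polyFun_mono ?_ le_rfl (hterm _ k (hB k))
    have := Finset.mem_range.1 hk
    omega
  have hp : (∑ k ∈ Finset.range (D - 1), (-((k + 1 : ℝ) / D)) •
      fun z : ℝ × (Fin 1 → ℝ) => (Q.coeff (k + 1)).eval z.1 * z.2 0 ^ k)
      ∈ polyFun (Fin 1) (D - 1 - 1) B := by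
    refine Submodule.sum_mem _ fun k hk => Submodule.smul_mem _ _
      (polyFun_mono ?_ le_rfl (hterm _ k (hB _)))
    have := Finset.mem_range.1 hk
    omega
  have hsol : ∀ z ∈ {z : ℝ × (Fin 1 → ℝ) | ((Q.map (evalRingHom z.1)).derivative).eval (z.2 0) = 0},
      ∀ i : Fin 1, z.2 i ^ (D - 1) = (∑ k ∈ Finset.range (D - 1), (-((k + 1 : ℝ) / D)) •
        fun z : ℝ × (Fin 1 → ℝ) => (Q.coeff (k + 1)).eval z.1 * z.2 0 ^ k) z := by
    intro z hz i
    have hz' : ((Q.map (evalRingHom z.1)).derivative).eval (z.2 0) = 0 := hz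
    have hDpos : (D : ℝ) ≠ 0 := by positivity
    have hsum : ((Q.map (evalRingHom z.1)).derivative).eval (z.2 0)
        = ∑ k ∈ Finset.range (D - 1 + 1),
          ((Q.coeff (k + 1)).eval z.1 * (k + 1)) * z.2 0 ^ k := by
      rw [eval_eq_sum_range' (n := D - 1 + 1)]
      · simp [coeff_derivative]
      · refine (natDegree_derivative_lt ?_).trans_le ?_
        · rw [hQ.natDegree_map]; omega
        · rw [hQ.natDegree_map]; omega
    have hlead : Q.coeff (D - 1 + 1) = 1 := by
      rw [Nat.sub_add_cancel (by omega), ← hQD]; exact hQ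
    rw [hsum, Finset.sum_range_succ, hlead] at hz'
    have hcast : ((D - 1 : ℕ) : ℝ) + 1 = D := by
      rw [← Nat.cast_add_one, Nat.sub_add_cancel (by omega)]
    rw [eval_one, one_mul, hcast] at hz'
    have hi : i = 0 := Subsingleton.elim _ _
    rw [hi, Finset.sum_apply]
    apply mul_left_cancel₀ hDpos
    rw [eq_neg_of_add_eq_zero_right hz', Finset.mul_sum, ← Finset.sum_neg_distrib]
    refine Finset.sum_congr rfl fun k _ => ?_
    simp only [Pi.smul_apply, smul_eq_mul]
    field_simp
  obtain ⟨R, hR, -, hRB, hRS⟩ := exists_monic_annihilator (by omega) (fun _ => hp) hsol hQ'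
  exact ⟨R, hR, hRB, fun s y h => hRS (s, fun _ => y) h⟩

/-- The minimum of a continuous family of functions over a compact interval reaches intermediate
values. -/
theorem exists_isMinOn_eq {F : ℝ × ℝ → ℝ} (hF : Continuous F) {a b : ℝ} (hab : a ≤ b)
    {s s₁ v : ℝ} (hs : ∃ y ∈ Set.Icc a b, F (s, y) ≤ v) (hs₁ : ∀ y ∈ Set.Icc a b, v < F (s₁, y)) :
    ∃ s' ∈ Set.uIcc s s₁, ∃ y ∈ Set.Icc a b, F (s', y) = v ∧ ∀ y' ∈ Set.Icc a b,
      v ≤ F (s', y') := by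
  have hne : (Set.Icc a b).Nonempty := ⟨a, le_rfl, hab⟩
  have hcont : Continuous fun s => sInf ((fun s y => F (s, y)) s '' Set.Icc a b) :=
    isCompact_Icc.continuous_sInf (f := fun s y => F (s, y)) hF
  have hmin : ∀ s, ∃ y ∈ Set.Icc a b, sInf ((fun s y => F (s, y)) s '' Set.Icc a b) = F (s, y) ∧
      ∀ y' ∈ Set.Icc a b, F (s, y) ≤ F (s, y') := fun s =>
    isCompact_Icc.exists_sInf_image_eq_and_le hne (hF.comp (by fun_prop)).continuousOn
  have hmem : v ∈ Set.uIcc (sInf ((fun s y => F (s, y)) s '' Set.Icc a b))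
      (sInf ((fun s y => F (s, y)) s₁ '' Set.Icc a b)) := by
    obtain ⟨y, hy, hyv⟩ := hs
    obtain ⟨y0, -, h0, h0'⟩ := hmin s
    obtain ⟨y1, hy1, h1, -⟩ := hmin s₁
    refine Set.mem_uIcc.2 (Or.inl ⟨?_, ?_⟩)
    · rw [h0]; exact (h0' y hy).trans hyv
    · rw [h1]; exact (hs₁ y1 hy1).le
  obtain ⟨s', hs', hv⟩ := intermediate_value_uIcc hcont.continuousOn hmem
  obtain ⟨y, hy, h1, h2⟩ := hmin s'
  refine ⟨s', hs', y, hy, ?_, fun y' hy' => ?_⟩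
  · rw [← h1]; exact hv
  · rw [← hv]; exact h1.le.trans (h2 y' hy')

/-- Away from a controlled number of parameters, the real roots of a monic family of polynomials
stay in a bounded number of cells of a grid. -/
theorem exists_breakpoints {D B : ℕ} (hD : 2 ≤ D) : ∃ B' : ℕ, ∀ Q : ℝ[X][X],
    Q.Monic → Q.natDegree = D → CoeffDegLE B Q → ∀ r : ℝ, 0 < r → ∀ m : ℕ,
    ∃ T : Finset ℝ, T.card ≤ B' * (m + 1) ∧ ∀ s₁ : ℝ, ∃ Z : Finset ℤ, Z.card ≤ 4 * D ∧
      ∀ s : ℝ, (s ≠ s₁ → ∀ t ∈ T, t ∉ Set.uIcc s s₁) → ∀ y : ℝ, |y| ≤ m * r →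
        (Q.map (evalRingHom s)).eval y = 0 → ⌊y / r⌋ ∈ Z := by
  classical
  obtain ⟨B₁, hB₁⟩ := exists_monic_annihilator_critical (B := B) hD
  refine ⟨2 * B₁ + 4 * B, fun Q hQ hQD hQB r hr m => ?_⟩
  obtain ⟨R, hR, hRB, hRQ⟩ := hB₁ Q hQ hQD hQB
  let J : Finset ℤ := Finset.Icc (-m : ℤ) (m + 1)
  have hJ : J.card = 2 * m + 2 := by
    rw [Int.card_Icc]; omega
  -- generic small level
  obtain ⟨η, hη0, hηr, hηR, hηR', hηJ, hηJ'⟩ : ∃ η : ℝ, 0 < η ∧ η ≤ r ^ D ∧ R.eval (C η) ≠ 0 ∧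
      R.eval (C (-η)) ≠ 0 ∧ (∀ j ∈ J, Q.eval (C (j * r)) - C η ≠ 0) ∧
      (∀ j ∈ J, Q.eval (C (j * r)) - C (-η) ≠ 0) := by
    have hf1 : {η : ℝ | R.eval (C η) = 0}.Finite := by
      refine (R.roots.toFinset.finite_toSet.preimage (f := C) C_injective.injOn).subset ?_
      intro η hη
      simpa [hR.ne_zero] using hη
    have hf2 : {η : ℝ | R.eval (C (-η)) = 0}.Finite :=
      hf1.preimage (f := fun η => -η) neg_injective.injOn
    have hf3 : (⋃ j ∈ J, {η : ℝ | Q.eval (C (j * r)) - C η = 0}).Finite := by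
      refine J.finite_toSet.biUnion fun j _ => Set.Subsingleton.finite fun x hx y hy => ?_
      exact C_injective ((sub_eq_zero.1 hx).symm.trans (sub_eq_zero.1 hy))
    have hf4 : (⋃ j ∈ J, {η : ℝ | Q.eval (C (j * r)) - C (-η) = 0}).Finite := by
      refine J.finite_toSet.biUnion fun j _ => Set.Subsingleton.finite fun x hx y hy => ?_
      exact neg_injective (C_injective ((sub_eq_zero.1 hx).symm.trans (sub_eq_zero.1 hy)))
    obtain ⟨η, hη, hηn⟩ := ((Set.Ioo_infinite (pow_pos hr D)).sdiff
      (((hf1.union hf2).union hf3).union hf4)).nonempty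
    simp only [Set.mem_union, Set.mem_ofPred_eq, Set.mem_iUnion, not_or, not_exists] at hηn
    exact ⟨η, hη.1, hη.2.le, hηn.1.1.1, hηn.1.1.2, hηn.1.2, hηn.2⟩
  let T : Finset ℝ := ((R.eval (C η)).roots.toFinset ∪ (R.eval (C (-η))).roots.toFinset) ∪
    (J.biUnion (fun j => (Q.eval (C (j * r)) - C η).roots.toFinset) ∪
      J.biUnion (fun j => (Q.eval (C (j * r)) - C (-η)).roots.toFinset))
  have hroots : ∀ (P : ℝ[X]) (b : ℕ), P.natDegree ≤ b → P.roots.toFinset.card ≤ b := fun P b hP =>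
    (Multiset.toFinset_card_le _).trans ((card_roots' _).trans hP)
  have hTcard : T.card ≤ (2 * B₁ + 4 * B) * (m + 1) := by
    have h1 := hroots _ _ (hRB.eval η)
    have h2 := hroots _ _ (hRB.eval (-η))
    have h3 : ∀ v : ℝ,
        (J.biUnion (fun j => (Q.eval (C (j * r)) - C v).roots.toFinset)).card ≤ J.card * B := by
      intro v
      refine Finset.card_biUnion_le_card_mul _ _ _ fun j _ => hroots _ _ ?_
      rw [natDegree_sub_C]
      exact hQB.eval _
    have h4 := h3 η
    have h5 := h3 (-η)
    rw [hJ] at h4 h5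
    have h6 : T.card ≤ (B₁ + B₁) + ((2 * m + 2) * B + (2 * m + 2) * B) :=
      (Finset.card_union_le _ _).trans (add_le_add
        ((Finset.card_union_le _ _).trans (add_le_add h1 h2))
        ((Finset.card_union_le _ _).trans (add_le_add h4 h5)))
    nlinarith [Nat.zero_le (B₁ * m)]
  have hTR : ∀ s v : ℝ, (v = η ∨ v = -η) → (R.map (evalRingHom s)).eval v = 0 → s ∈ T := by
    rintro s v hv h
    rw [eval_map_evalRingHom_eq_eval_eval] at h
    refine Finset.mem_union_left _ ?_
    rcases hv with rfl | rfl
    · exact Finset.mem_union_left _ (Multiset.mem_toFinset.2 ((mem_roots hηR).2 h))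
    · exact Finset.mem_union_right _ (Multiset.mem_toFinset.2 ((mem_roots hηR').2 h))
  have hTJ : ∀ (s v : ℝ) (j : ℤ), j ∈ J → (v = η ∨ v = -η) →
      (Q.map (evalRingHom s)).eval (j * r) = v → s ∈ T := by
    rintro s v j hj hv h
    rw [eval_map_evalRingHom_eq_eval_eval] at h
    refine Finset.mem_union_right _ ?_
    rcases hv with rfl | rfl
    · refine Finset.mem_union_left _ (Finset.mem_biUnion.2
        ⟨j, hj, Multiset.mem_toFinset.2 ((mem_roots (hηJ j hj)).2 ?_)⟩)
      rw [IsRoot, eval_sub, eval_C, h, sub_self]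
    · refine Finset.mem_union_right _ (Finset.mem_biUnion.2
        ⟨j, hj, Multiset.mem_toFinset.2 ((mem_roots (hηJ' j hj)).2 ?_)⟩)
      rw [IsRoot, eval_sub, eval_C, h, sub_self]
  refine ⟨T, hTcard, fun s₁ => ?_⟩
  have hdeg : (Q.map (evalRingHom s₁)).natDegree = D := by rw [hQ.natDegree_map, hQD]
  obtain ⟨Z, hZ, hZ'⟩ := exists_finset_near_roots (hQ.map (evalRingHom s₁)) (by omega) hr
  rw [hdeg] at hZ hZ'
  refine ⟨Z, hZ, fun s hs y hy hroot => ?_⟩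
  by_contra hj
  set j := ⌊y / r⌋ with hjdef
  have hjl : (j : ℝ) ≤ y / r := Int.floor_le _
  have hju : y / r < j + 1 := Int.lt_floor_add_one _
  rw [le_div_iff₀ hr] at hjl
  rw [div_lt_iff₀ hr] at hju
  obtain ⟨hy1, hy2⟩ := abs_le.1 hy
  have hjJ : j ∈ J ∧ j + 1 ∈ J := by
    have h1 : (-m : ℝ) < j + 1 := by
      by_contra! h; nlinarith
    have h2 : (j : ℝ) ≤ m := by
      by_contra! h; nlinarith
    have h1' : (-m : ℤ) < j + 1 := by exact_mod_cast h1
    have h2' : j ≤ m := by exact_mod_cast h2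
    simp only [J, Finset.mem_Icc]
    omega
  have hab : (j : ℝ) * r ≤ (j + 1) * r := by nlinarith
  obtain ⟨s', hs', y', hy', hval, hmin⟩ := exists_isMinOn_eq
    (F := fun z => (Q.map (evalRingHom z.1)).eval z.2 ^ 2)
    ((continuous_eval_map_evalRingHom Q).pow 2) hab (s := s) (s₁ := s₁) (v := η ^ 2)
    ⟨y, ⟨hjl, hju.le⟩, by simpa [hroot] using sq_nonneg η⟩ (fun x hx => by
      by_contra! h
      exact hj (hZ' j x hx ((abs_le_of_sq_le_sq' h hη0.le |> abs_le.2).trans hηr)))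
  simp only at hval hmin
  have hpm : (Q.map (evalRingHom s')).eval y' = η ∨ (Q.map (evalRingHom s')).eval y' = -η :=
    sq_eq_sq_iff_eq_or_eq_neg.1 hval
  have hne : s ≠ s₁ := by
    rintro rfl
    exact hj (hZ' j y ⟨hjl, hju.le⟩ (by rw [hroot, abs_zero]; positivity))
  refine hs hne s' ?_ hs'
  rcases hy'.1.eq_or_lt with h | h
  · refine hTJ s' _ j hjJ.1 hpm (by rw [h])
  rcases hy'.2.eq_or_lt with h' | h'
  · refine hTJ s' _ (j + 1) hjJ.2 hpm (by push_cast; rw [h'])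
  refine hTR s' _ hpm (hRQ s' y' ?_)
  have hlm : IsLocalMin (fun x => (Q.map (evalRingHom s')).eval x ^ 2) y' := by
    filter_upwards [Icc_mem_nhds h h'] with x hx
    rw [hval]
    exact hmin x hx
  have hder := hlm.hasDerivAt_eq_zero (((Q.map (evalRingHom s')).hasDerivAt y').pow 2)
  have hne : (Q.map (evalRingHom s')).eval y' ≠ 0 := by
    rcases hpm with h | h <;> rw [h]
    · exact hη0.ne'
    · exact (neg_neg_of_pos hη0).ne
  simpa [hne] using hder

end Cells

section Covering

open MvPolynomial

variable {σ : Type}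

theorem totalDegree_pderiv_le [Fintype σ] (i : σ) (P : MvPolynomial σ ℝ) :
    (pderiv i P).totalDegree ≤ P.totalDegree := by
  conv_lhs => rw [P.as_sum, map_sum]
  refine totalDegree_finsetSum_le fun d hd => ?_
  rw [pderiv_monomial]
  refine (totalDegree_monomial_le _ _).trans (le_trans ?_ (le_totalDegree hd))
  rw [Finsupp.sum_fintype _ _ (fun _ => rfl), Finsupp.sum_fintype _ _ (fun _ => rfl)]
  exact Finset.sum_le_sum fun l _ => by simp

theorem hasDerivAt_eval_update [DecidableEq σ] (P : MvPolynomial σ ℝ) (y : σ → ℝ) (i : σ) :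
    HasDerivAt (fun t => eval (Function.update y i t) P) (eval y (pderiv i P)) (y i) := by
  induction P using MvPolynomial.induction_on with
  | C a => simpa using hasDerivAt_const (y i) a
  | add p q hp hq => simpa using hp.fun_add hq
  | mul_X p l hp =>
    have hX : HasDerivAt (fun t => Function.update y i t l) (if l = i then 1 else 0) (y i) := by
      by_cases h : l = i
      · subst h; simpa using hasDerivAt_id' (y l)
      · simpa [h] using hasDerivAt_const (y i) (y l)
    have h := hp.fun_mul hX
    simp only [Function.update_eq_self] at h
    have h1 : eval y (pderiv i (p * X l))
        = eval y (pderiv i p) * y l + eval y p * (if l = i then 1 else 0) := by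
      rw [Derivation.leibniz, pderiv_X]
      simp only [smul_eq_mul, map_add, map_mul, eval_X, Pi.single_apply]
      split_ifs <;> simp <;> ring
    rw [h1]
    simpa using h

theorem exists_forall_add_pow_le [Fintype σ] {G : (σ → ℝ) → ℝ} (hG : Continuous G)
    (hG0 : ∀ y, 0 ≤ G y) {ε : ℝ} (hε : 0 < ε) {d : ℕ} (hd : 0 < d) :
    ∃ y, ∀ x, G y + ε * ∑ i, y i ^ (2 * d) ≤ G x + ε * ∑ i, x i ^ (2 * d) := by
  have hpow : ∀ x : ℝ, 0 ≤ x ^ (2 * d) := fun x => (even_two_mul d).pow_nonneg x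
  set F : (σ → ℝ) → ℝ := fun x => G x + ε * ∑ i, x i ^ (2 * d)
  have hF : Continuous F := by fun_prop
  refine hF.exists_forall_le' 0 ?_
  have hF0 : 0 ≤ F 0 := add_nonneg (hG0 0) (mul_nonneg hε.le (Finset.sum_nonneg fun i _ => hpow _))
  have hcpt : IsCompact (Metric.closedBall (0 : σ → ℝ) (1 + F 0 / ε)) := isCompact_closedBall _ _
  filter_upwards [hcpt.compl_mem_cocompact] with x hx
  by_contra! hlt
  refine hx ?_
  have hnn : 0 ≤ F 0 / ε := div_nonneg hF0 hε.le
  rw [mem_closedBall_zero_iff, pi_norm_le_iff_of_nonneg (by linarith)]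
  intro i
  have h1 : x i ^ (2 * d) ≤ ∑ l, x l ^ (2 * d) :=
    Finset.single_le_sum (f := fun l => x l ^ (2 * d)) (fun l _ => hpow _) (Finset.mem_univ i)
  have h2 : ε * ∑ l, x l ^ (2 * d) ≤ F 0 := by
    have : F x = G x + ε * ∑ l, x l ^ (2 * d) := rfl
    linarith [hG0 x]
  have h3 : x i ^ (2 * d) ≤ F 0 / ε := by
    rw [le_div_iff₀ hε]; nlinarith
  rw [Real.norm_eq_abs]
  by_contra! h4
  have h5 : |x i| ≤ |x i| ^ (2 * d) := le_self_pow₀ (by linarith) (by omega)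
  rw [pow_mul, sq_abs, ← pow_mul] at h5
  linarith

variable [Fintype σ] {f g h : MvPolynomial σ ℝ}

/-- Near the zero set of `h`, points can be moved into the zero set with small effect on `f`
and `g`. -/
theorem exists_zero_near (hh : ∀ y, 0 ≤ eval y h)
    (hK : Bornology.IsBounded {y : σ → ℝ | eval y h ≤ 1}) {δ : ℝ} (hδ : 0 < δ) :
    ∃ θ, 0 < θ ∧ θ ≤ 1 ∧ ∀ y, eval y h ≤ θ → ∃ x, eval x h = 0 ∧ dist y x ≤ δ ∧
      |eval y f - eval x f| ≤ δ ∧ |eval y g - eval x g| ≤ δ := by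
  have cont : ∀ P : MvPolynomial σ ℝ, Continuous fun y : σ → ℝ => eval y P :=
    fun P => P.continuous_eval
  set V : Set (σ → ℝ) := {y | ∃ x, eval x h = 0 ∧ dist y x < δ ∧ |eval y f - eval x f| < δ ∧
    |eval y g - eval x g| < δ} with hV
  have hVo : IsOpen V := by
    have : V = ⋃ x ∈ {x | eval x h = 0}, ({y | dist y x < δ} ∩
        ({y | |eval y f - eval x f| < δ} ∩ {y | |eval y g - eval x g| < δ})) := by
      ext y
      simp only [hV, Set.mem_iUnion, Set.mem_inter_iff, Set.mem_ofPred_eq, exists_prop]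
    rw [this]
    have cf := cont f
    have cg := cont g
    exact isOpen_biUnion fun x _ => (isOpen_lt (by fun_prop) continuous_const).inter
      ((isOpen_lt (by fun_prop) continuous_const).inter
        (isOpen_lt (by fun_prop) continuous_const))
  have hcpt : IsCompact ({y : σ → ℝ | eval y h ≤ 1} \ V) :=
    (Metric.isCompact_of_isClosed_isBounded (isClosed_le (cont h) continuous_const) hK).diff hVo
  have key : ∃ θ, 0 < θ ∧ θ ≤ 1 ∧ ∀ y, eval y h ≤ θ → y ∈ V := by
    rcases Set.eq_empty_or_nonempty ({y : σ → ℝ | eval y h ≤ 1} \ V) with he | hne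
    · refine ⟨1, one_pos, le_rfl, fun y hy => ?_⟩
      by_contra hyV
      exact Set.notMem_empty y (he ▸ ⟨hy, hyV⟩)
    · obtain ⟨y0, hy0, hmin⟩ := hcpt.exists_isMinOn hne (cont h).continuousOn
      have hpos : 0 < eval y0 h := by
        refine (hh y0).lt_of_ne fun h0 => hy0.2 ⟨y0, h0.symm, ?_⟩
        simp [hδ]
      refine ⟨min 1 (eval y0 h / 2), by positivity, min_le_left _ _, fun y hy => ?_⟩
      by_contra hyV
      have h1 : eval y h ≤ 1 := hy.trans (min_le_left _ _)
      have h2 : eval y h ≤ eval y0 h / 2 := hy.trans (min_le_right _ _)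
      have h3 : eval y0 h ≤ eval y h := hmin ⟨h1, hyV⟩
      linarith
  obtain ⟨θ, h0, h1, h2⟩ := key
  refine ⟨θ, h0, h1, fun y hy => ?_⟩
  obtain ⟨x, hx, ha, hb, hc⟩ := h2 y hy
  exact ⟨x, hx, ha.le, hb.le, hc.le⟩

/-- Minimizers of a penalized functional approximate the minimizers of `g` on a level of `f` inside
the zero set of `h`. -/
theorem exists_penalty (hg : ∀ y, 0 ≤ eval y g) (hh : ∀ y, 0 ≤ eval y h)
    (hK : Bornology.IsBounded {y : σ → ℝ | eval y h ≤ 1}) (d : ℕ) {δ : ℝ} (hδ : 0 < δ) :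
    ∃ M ε : ℝ, 0 < M ∧ 0 < ε ∧ ∀ (s : ℝ) (w : σ → ℝ),
      (∀ x, eval w g + M * (eval w f - s) ^ 2 + M * eval w h + ε * ∑ i, w i ^ (2 * d) ≤
        eval x g + M * (eval x f - s) ^ 2 + M * eval x h + ε * ∑ i, x i ^ (2 * d)) →
      (∃ x, eval x h = 0 ∧ eval x f = s) →
      eval w h ≤ 1 ∧ ∃ y, eval y h = 0 ∧ dist w y ≤ δ ∧ |eval y f - s| ≤ 2 * δ ∧
        ∀ x, eval x h = 0 → eval x f = s → eval y g ≤ eval x g + 2 * δ := by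
  have cont : ∀ P : MvPolynomial σ ℝ, Continuous fun y : σ → ℝ => eval y P :=
    fun P => P.continuous_eval
  obtain ⟨θ, hθ, hθ1, hnear⟩ := exists_zero_near (f := f) (g := g) hh hK hδ
  have hcpt : IsCompact {y : σ → ℝ | eval y h ≤ 1} :=
    Metric.isCompact_of_isClosed_isBounded (isClosed_le (cont h) continuous_const) hK
  have hpow : ∀ x : σ → ℝ, 0 ≤ ∑ i, x i ^ (2 * d) := fun x =>
    Finset.sum_nonneg fun i _ => (even_two_mul d).pow_nonneg _
  obtain ⟨E, hE⟩ := hcpt.bddAbove_image (f := fun x : σ → ℝ => ∑ i, x i ^ (2 * d))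
    (by fun_prop : Continuous fun x : σ → ℝ => ∑ i, x i ^ (2 * d)).continuousOn
  obtain ⟨A, hA⟩ := hcpt.bddAbove_image (f := fun x : σ → ℝ => eval x g) (cont g).continuousOn
  have hE' : ∀ x, eval x h = 0 → ∑ i, x i ^ (2 * d) ≤ |E| := fun x hx =>
    (hE ⟨x, by simp [hx], rfl⟩).trans (le_abs_self E)
  have hA' : ∀ x, eval x h = 0 → eval x g ≤ |A| := fun x hx =>
    (hA ⟨x, by simp [hx], rfl⟩).trans (le_abs_self A)
  set ε := δ / (|E| + 1) with hεdef
  have hε : 0 < ε := by positivity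
  have hεE : ε * |E| ≤ δ := by
    rw [hεdef, div_mul_eq_mul_div, div_le_iff₀ (by positivity)]
    nlinarith [abs_nonneg E]
  set M := (|A| + δ) / min θ (δ ^ 2) with hMdef
  have hmin : 0 < min θ (δ ^ 2) := by positivity
  have hM : 0 < M := by positivity
  have hMmin : M * min θ (δ ^ 2) = |A| + δ := div_mul_cancel₀ _ hmin.ne'
  refine ⟨M, ε, hM, hε, fun s w hw hs => ?_⟩
  have hb : ∀ x, eval x h = 0 → eval x f = s →
      eval w g + M * (eval w f - s) ^ 2 + M * eval w h ≤ eval x g + δ := by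
    intro x hx hxs
    have h1 := hw x
    rw [hx, hxs] at h1
    have h2 := mul_le_mul_of_nonneg_left (hE' x hx) hε.le
    have h3 := mul_nonneg hε.le (hpow w)
    nlinarith
  obtain ⟨x0, hx0, hx0s⟩ := hs
  have hb0 := hb x0 hx0 hx0s
  have hA0 := hA' x0 hx0
  have hsq : 0 ≤ M * (eval w f - s) ^ 2 := by positivity
  have hMh : 0 ≤ M * eval w h := mul_nonneg hM.le (hh w)
  have hwh : eval w h ≤ min θ (δ ^ 2) := by
    refine le_of_mul_le_mul_left ?_ hM
    rw [hMmin]; linarith [hg w]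
  have hwf : (eval w f - s) ^ 2 ≤ min θ (δ ^ 2) := by
    refine le_of_mul_le_mul_left ?_ hM
    rw [hMmin]; linarith [hg w]
  have hwf' : |eval w f - s| ≤ δ := abs_le_of_sq_le_sq (hwf.trans (min_le_right _ _)) hδ.le
  obtain ⟨y, hy, hd, hyf, hyg⟩ := hnear w (hwh.trans (min_le_left _ _))
  refine ⟨(hwh.trans (min_le_left _ _)).trans hθ1, y, hy, hd, ?_, fun x hx hxs => ?_⟩
  · have h1 := abs_le.1 hwf'
    have h2 := abs_le.1 hyf
    rw [abs_le]; constructor <;> linarith [h1.1, h1.2, h2.1, h2.2]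
  · have h1 := hb x hx hxs
    have h2 := abs_le.1 hyg
    linarith [h2.1, h2.2]

variable [DecidableEq σ]

/-- Minimizers of the penalized functional satisfy a triangular-type polynomial system. -/
theorem exists_critical_system (f g h : MvPolynomial σ ℝ) (M : ℝ) {ε : ℝ} (hε : 0 < ε) {d k : ℕ}
    (hd : 0 < d) (hf : 2 * f.totalDegree ≤ k) (hg : g.totalDegree ≤ k) (hh : h.totalDegree ≤ k) :
    ∃ p : σ → ℝ × (σ → ℝ) → ℝ, (∀ i, p i ∈ polyFun σ k 1) ∧ ∀ (s : ℝ) (w : σ → ℝ),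
      (∀ x, eval w g + M * (eval w f - s) ^ 2 + M * eval w h + ε * ∑ i, w i ^ (2 * d) ≤
        eval x g + M * (eval x f - s) ^ 2 + M * eval x h + ε * ∑ i, x i ^ (2 * d)) →
      ∀ i, w i ^ (2 * d - 1) = p i (s, w) := by
  have hs : (fun z : ℝ × (σ → ℝ) => z.1) ∈ polyFun σ 0 1 := by
    simpa using eval_fst_mem_polyFun (σ := σ) (j := 1) Polynomial.X (by simp)
  refine ⟨fun i => (-(1 / (2 * d * ε))) •
    ((fun z : ℝ × (σ → ℝ) => eval z.2 (pderiv i g + C (2 * M) * (f * pderiv i f) + C M * pderiv i h))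
      - (2 * M) • ((fun z : ℝ × (σ → ℝ) => z.1) * fun z => eval z.2 (pderiv i f))),
    fun i => Submodule.smul_mem _ _ (Submodule.sub_mem _ ?_ (Submodule.smul_mem _ _ ?_)),
    fun s w hw i => ?_⟩
  · refine polyFun_mono le_rfl (Nat.zero_le 1) (eval_mem_polyFun _ ?_)
    have h1 := totalDegree_pderiv_le i g
    have h2 := totalDegree_pderiv_le i h
    have h3 := totalDegree_pderiv_le i f
    have h4 := totalDegree_mul f (pderiv i f)
    refine (totalDegree_add _ _).trans (max_le ((totalDegree_add _ _).trans (max_le ?_ ?_)) ?_)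
    · omega
    · refine (totalDegree_mul _ _).trans ?_
      rw [totalDegree_C]; omega
    · refine (totalDegree_mul _ _).trans ?_
      rw [totalDegree_C]; omega
  · have h3 := totalDegree_pderiv_le i f
    exact polyFun_mono (by omega) (by omega)
      (mul_mem_polyFun hs (eval_mem_polyFun (k := k) (pderiv i f) (by omega)))
  · set F : MvPolynomial σ ℝ := g + C M * (f - C s) ^ 2 + C M * h + C ε * ∑ l, X l ^ (2 * d)
    have hF : ∀ x, eval x F = eval x g + M * (eval x f - s) ^ 2 + M * eval x h
        + ε * ∑ l, x l ^ (2 * d) := by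
      intro x; simp [F]
    have hmin : IsLocalMin (fun t => eval (Function.update w i t) F) (w i) := by
      refine Filter.Eventually.of_forall fun t => ?_
      simp only [Function.update_eq_self, hF]
      exact hw _
    have hder := hmin.hasDerivAt_eq_zero (hasDerivAt_eval_update F w i)
    have hpd : eval w (pderiv i F) = eval w (pderiv i g) + M * (2 * (eval w f - s) *
        eval w (pderiv i f)) + M * eval w (pderiv i h) + ε * (2 * d * w i ^ (2 * d - 1)) := by
      have hX : pderiv i (∑ l, (X l : MvPolynomial σ ℝ) ^ (2 * d))
          = C (2 * d : ℝ) * X i ^ (2 * d - 1) := by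
        rw [map_sum, Finset.sum_eq_single i]
        · rw [pderiv_pow, pderiv_X_self]
          simp only [Nat.cast_mul, Nat.cast_ofNat, mul_one, map_mul, map_natCast]
          rw [show (C (2 : ℝ) : MvPolynomial σ ℝ) = 2 from map_ofNat C 2]
        · intro l _ hl
          rw [pderiv_pow, pderiv_X_of_ne hl]; simp
        · simp
      simp only [F, map_add, pderiv_C_mul, pderiv_pow, hX, map_sub, pderiv_C]
      simp
    rw [hpd] at hder
    have hdpos : (d : ℝ) ≠ 0 := by positivity
    simp only [Pi.smul_apply, Pi.sub_apply, Pi.mul_apply, smul_eq_mul, map_add, map_mul, eval_C]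
    field_simp
    linarith

end Covering

section Cells

open MvPolynomial

/-- The position of `s` relative to a finite set of reals. -/
noncomputable def cellLabel (T : Finset ℝ) (s : ℝ) : ℕ × Bool :=
  ((T.filter (· < s)).card, decide (s ∈ T))

theorem notMem_uIcc_of_cellLabel_eq {T : Finset ℝ} {s s' : ℝ} (h : cellLabel T s = cellLabel T s')
    (hne : s ≠ s') : ∀ t ∈ T, t ∉ Set.uIcc s s' := by
  wlog hlt : s < s' generalizing s s'
  · rw [Set.uIcc_comm]
    exact this h.symm hne.symm (lt_of_le_of_ne (not_lt.1 hlt) hne.symm)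
  rw [Set.uIcc_of_le hlt.le]
  intro t ht hts
  have hcard : (T.filter (· < s)).card = (T.filter (· < s')).card := congrArg Prod.fst h
  have hmem : s ∈ T ↔ s' ∈ T := by
    have := congrArg Prod.snd h
    simpa [cellLabel] using this
  have key : ∀ u ∈ T, s ≤ u → u < s' → False := by
    intro u hu h1 h2
    refine (Finset.card_lt_card (Finset.ssubset_iff_subset_ne.2 ⟨?_, ?_⟩)).ne hcard
    · intro x hx
      rw [Finset.mem_filter] at hx ⊢
      exact ⟨hx.1, hx.2.trans hlt⟩
    · intro heq
      have : u ∈ T.filter (· < s) := heq ▸ Finset.mem_filter.2 ⟨hu, h2⟩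
      exact absurd (Finset.mem_filter.1 this).2 (not_lt.2 h1)
  rcases hts.2.lt_or_eq with h2 | h2
  · exact key t ht hts.1 h2
  · exact key s (hmem.2 (h2 ▸ ht)) le_rfl hlt

variable {σ : Type} [Fintype σ] [DecidableEq σ] {f g h : MvPolynomial σ ℝ}

/-- The values of `f` on the zero set of `h` split into `O(1 / r)` cells on each of which the
minimizers of `g` can be chosen, approximately, within distance `O(r)` of each other. -/
theorem exists_cells [Nonempty σ] (hg : ∀ y, 0 ≤ eval y g) (hh : ∀ y, 0 ≤ eval y h)
    (hK : Bornology.IsBounded {y : σ → ℝ | eval y h ≤ 1}) :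
    ∃ L : ℝ, ∀ r : ℝ, 0 < r → r ≤ 1 → ∃ (Λ : Finset ((ℕ × Bool) × (σ → ℤ)))
      (c : ℝ → (ℕ × Bool) × (σ → ℤ)) (y : ℝ → σ → ℝ), Λ.card * r ≤ L ∧
      (∀ s, (∃ x, eval x h = 0 ∧ eval x f = s) → c s ∈ Λ ∧ eval (y s) h = 0 ∧
        |eval (y s) f - s| ≤ r ^ 2 ∧
        ∀ x, eval x h = 0 → eval x f = s → eval (y s) g ≤ eval x g + r ^ 2) ∧
      ∀ s s', (∃ x, eval x h = 0 ∧ eval x f = s) → (∃ x, eval x h = 0 ∧ eval x f = s') →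
        c s = c s' → dist (y s) (y s') ≤ 2 * r := by
  have cont : ∀ P : MvPolynomial σ ℝ, Continuous fun y : σ → ℝ => eval y P :=
    fun P => P.continuous_eval
  obtain ⟨R, hR, hKR⟩ := hK.exists_pos_norm_le
  set k := 2 * f.totalDegree + g.totalDegree + h.totalDegree with hk
  set d := k + 2 with hd
  set e := 2 * d - 1 with he
  set n := Fintype.card σ with hn
  have hn0 : n ≠ 0 := Fintype.card_ne_zero
  have he3 : 3 ≤ e := by omega
  have hD : 2 ≤ e ^ n := (by omega : 2 ≤ e).trans (Nat.le_self_pow hn0 e)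
  obtain ⟨B', hB'⟩ := exists_breakpoints (B := e ^ n * (0 + 1 * (1 + n * (e - 1)))) hD
  refine ⟨2 * (n * B' * (R + 2) + 1) * (4 * (e ^ n : ℕ)) ^ n, fun r hr hr1 => ?_⟩
  obtain ⟨M, ε, hM, hε, hpen⟩ := exists_penalty (f := f) hg hh hK d
    (show 0 < r ^ 2 / 2 by positivity)
  obtain ⟨p, hp, hcrit⟩ := exists_critical_system f g h M hε (d := d) (k := k) (by omega)
    (by omega) (by omega) (by omega)
  have hw : ∀ s : ℝ, ∃ w : σ → ℝ, ∀ x,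
      eval w g + M * (eval w f - s) ^ 2 + M * eval w h + ε * ∑ i, w i ^ (2 * d) ≤
        eval x g + M * (eval x f - s) ^ 2 + M * eval x h + ε * ∑ i, x i ^ (2 * d) := by
    intro s
    have cf := cont f
    have cg := cont g
    have ch := cont h
    refine exists_forall_add_pow_le
      (G := fun x => eval x g + M * (eval x f - s) ^ 2 + M * eval x h) (by fun_prop)
      (fun x => ?_) hε (by omega)
    have h1 := hg x
    have h2 := hh x
    positivity
  choose w hw using hw
  have hQ : ∀ i : σ, ∃ Q : Polynomial (Polynomial ℝ), Q.Monic ∧ Q.natDegree = e ^ n ∧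
      CoeffDegLE (e ^ n * (0 + 1 * (1 + n * (e - 1)))) Q ∧
      ∀ z ∈ {z : ℝ × (σ → ℝ) | ∀ i, z.2 i ^ e = p i z},
        (Q.map (Polynomial.evalRingHom z.1)).eval (z.2 i) = 0 := by
    intro i
    refine exists_monic_annihilator (k := 1) (j := 0) (p := p) (q := fun z => z.2 i)
      (by omega) (fun l => ?_) (fun z hz => hz) ?_
    · exact polyFun_mono (by omega) le_rfl (hp l)
    · simpa using eval_mem_polyFun (k := 1) (X i : MvPolynomial σ ℝ) (totalDegree_X i).le
  choose Q hQm hQd hQB hQ0 using hQ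
  set m := ⌈R / r⌉₊ with hm
  have hmr : R ≤ m * r := (div_le_iff₀ hr).1 (Nat.le_ceil _)
  have hmr' : (m + 1) * r ≤ R + 2 := by
    have h1 : (m : ℝ) < R / r + 1 := Nat.ceil_lt_add_one (by positivity)
    have h2 : R / r * r = R := div_mul_cancel₀ _ hr.ne'
    nlinarith
  choose T hTc hT using fun i => hB' (Q i) (hQm i) (hQd i) (hQB i) r hr m
  set T' : Finset ℝ := Finset.univ.biUnion T with hT'
  have hT'c : T'.card ≤ n * (B' * (m + 1)) := by
    refine Finset.card_biUnion_le.trans ((Finset.sum_le_card_nsmul _ _ _ fun i _ => hTc i).trans ?_)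
    simp [hn]
  choose Z hZc hZ using hT
  have hrep : ∀ a : ℕ × Bool, ∃ s₁ : ℝ, ∀ s, cellLabel T' s = a → cellLabel T' s₁ = a := by
    intro a
    by_cases ha : ∃ s, cellLabel T' s = a
    · obtain ⟨s, hs⟩ := ha
      exact ⟨s, fun _ _ => hs⟩
    · exact ⟨0, fun s hs => (ha ⟨s, hs⟩).elim⟩
  choose s₁ hs₁ using hrep
  have hy : ∀ s, ∃ y : σ → ℝ, (∃ x, eval x h = 0 ∧ eval x f = s) → eval (w s) h ≤ 1 ∧
      eval y h = 0 ∧ dist (w s) y ≤ r ^ 2 / 2 ∧ |eval y f - s| ≤ r ^ 2 ∧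
        ∀ x, eval x h = 0 → eval x f = s → eval y g ≤ eval x g + r ^ 2 := by
    intro s
    by_cases hs : ∃ x, eval x h = 0 ∧ eval x f = s
    · obtain ⟨h1, y, h2, h3, h4, h5⟩ := hpen s (w s) (hw s) hs
      rw [mul_div_cancel₀ _ two_ne_zero] at h4 h5
      exact ⟨y, fun _ => ⟨h1, h2, h3, h4, h5⟩⟩
    · exact ⟨0, fun h => (hs h).elim⟩
  choose y hy using hy
  refine ⟨(Finset.range (T'.card + 1) ×ˢ Finset.univ).biUnion fun a =>
      (Fintype.piFinset fun i => Z i (s₁ a)).image fun z => (a, z),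
    fun s => (cellLabel T' s, fun i => ⌊w s i / r⌋), y, ?_, fun s hs => ?_, fun s s' hs hs' hc => ?_⟩
  · have h1 : ∀ a : ℕ × Bool, ((Fintype.piFinset fun i => Z i (s₁ a)).image fun z => (a, z)).card
        ≤ (4 * e ^ n) ^ n := by
      intro a
      refine Finset.card_image_le.trans ?_
      rw [Fintype.card_piFinset]
      exact (Finset.prod_le_pow_card _ _ _ fun i _ => hZc i _).trans (by simp [hn])
    have h2 := Finset.card_biUnion_le.trans (Finset.sum_le_card_nsmul
      (Finset.range (T'.card + 1) ×ˢ (Finset.univ : Finset Bool)) _ _ fun a _ => h1 a)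
    rw [Finset.card_product, Finset.card_range, Finset.card_univ, Fintype.card_bool,
      smul_eq_mul] at h2
    have h3 : ((_ : ℕ) : ℝ) ≤ _ := Nat.cast_le.2 (h2.trans (Nat.mul_le_mul_right _
      (Nat.mul_le_mul_right _ (Nat.succ_le_succ hT'c))))
    refine (mul_le_mul_of_nonneg_right h3 hr.le).trans ?_
    push_cast
    have h4 : (0 : ℝ) ≤ n * B' := by positivity
    have h5 : ((n : ℝ) * (B' * (m + 1)) + 1) * r ≤ n * B' * (R + 2) + 1 := by
      nlinarith [mul_le_mul_of_nonneg_left hmr' h4]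
    have h6 : (0 : ℝ) ≤ (4 * (e : ℝ) ^ n) ^ n := by positivity
    have h7 := mul_le_mul_of_nonneg_right h5 h6
    nlinarith
  · obtain ⟨h1, h2, h3, h4, h5⟩ := hy s hs
    refine ⟨?_, h2, h4, h5⟩
    refine Finset.mem_biUnion.2 ⟨cellLabel T' s, ?_, Finset.mem_image_of_mem _ ?_⟩
    · simp only [Finset.mem_product, Finset.mem_univ, and_true, Finset.mem_range]
      exact Nat.lt_succ_of_le (Finset.card_filter_le _ _)
    · refine Fintype.mem_piFinset.2 fun i => hZ i _ s (fun hne t ht => ?_) _ ?_ ?_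
      · exact notMem_uIcc_of_cellLabel_eq (hs₁ _ s rfl).symm hne t
          (Finset.mem_biUnion.2 ⟨i, Finset.mem_univ _, ht⟩)
      · exact ((norm_le_pi_norm (w s) i).trans (hKR _ h1)).trans hmr
      · exact hQ0 i (s, w s) (hcrit s (w s) (hw s))
  · obtain ⟨-, -, h3, -⟩ := hy s hs
    obtain ⟨-, -, h3', -⟩ := hy s' hs'
    have hww : dist (w s) (w s') ≤ r := by
      refine (dist_pi_le_iff hr.le).2 fun i => ?_
      have h1 := congrFun (congrArg Prod.snd hc) i
      have h2 := (Int.abs_sub_lt_one_of_floor_eq_floor h1).le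
      rwa [← sub_div, abs_div, abs_of_pos hr, div_le_one hr] at h2
    have h4 := dist_triangle4 (y s) (w s) (w s') (y s')
    rw [dist_comm (y s) (w s)] at h4
    nlinarith

end Cells

section Length

open MeasureTheory

theorem setIntegral_le_of_cells {E ι : Type*} [PseudoMetricSpace E] {K : Set E}
    {f γ : E → ℝ} {C : ℝ} (hC : 1 ≤ C) (hγ : ∀ x, 0 ≤ γ x)
    (hLip : ∀ x ∈ K, ∀ y ∈ K, |γ x - γ y| ≤ C * dist x y)
    (hvar : ∀ x ∈ K, ∀ y ∈ K, |f x - f y| ≤ C * (γ x * dist x y + dist x y ^ 2))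
    {L r η : ℝ} (hr : 0 < r) (hrη : 6 * C * r ≤ η) {Λ : Finset ι} {c : ℝ → ι} {y : ℝ → E}
    (hΛ : Λ.card * r ≤ L)
    (hy : ∀ x ∈ K, c (f x) ∈ Λ ∧ y (f x) ∈ K ∧ |f (y (f x)) - f x| ≤ r ^ 2 ∧
      γ (y (f x)) ^ 2 ≤ γ x ^ 2 + r ^ 2)
    (hyy : ∀ x ∈ K, ∀ x' ∈ K, c (f x) = c (f x') → dist (y (f x)) (y (f x')) ≤ 2 * r)
    {u : ℝ → E} {T : ℝ} (hT : 0 ≤ T) (huK : ∀ t ∈ Set.Icc 0 T, u t ∈ K)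
    (hγu : ContinuousOn (fun t => γ (u t)) (Set.Icc 0 T))
    (hfu : ∀ t ∈ Set.Icc 0 T, HasDerivAt (fun t => f (u t)) (γ (u t) ^ 2) t) :
    ∫ t in Set.Icc 0 T, γ (u t) ≤ 4 * C * L + η * T := by
  have hC0 : 0 < C := by linarith
  have hη : 0 < η := lt_of_lt_of_le (by positivity) hrη
  have hfc : ContinuousOn (fun t => f (u t)) (Set.Icc 0 T) := fun t ht =>
    (hfu t ht).continuousAt.continuousWithinAt
  have hle : ∀ x ∈ K, γ (y (f x)) ≤ γ x + r := fun x hx =>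
    abs_le_of_sq_le_sq' (by nlinarith [(hy x hx).2.2.2, hγ x]) (by linarith [hγ x]) |>.2
  have hψ : ∀ P : ι, ∃ ψ : ℝ → ℝ, IntegrableOn ψ (Set.Icc 0 T) ∧ (∀ t, 0 ≤ ψ t) ∧
      ∫ t in Set.Icc 0 T, ψ t ≤ 4 * C * r ∧
      ∀ t ∈ Set.Icc 0 T, c (f (u t)) = P → γ (u t) ^ 2 / (γ (u t) + η) ≤ ψ t := by
    intro P
    by_cases hP : ∃ t ∈ Set.Icc 0 T, c (f (u t)) = P
    swap
    · push Not at hP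
      exact ⟨fun _ => 0, integrableOn_zero, fun _ => le_rfl, by simp; positivity,
        fun t ht h => (hP t ht h).elim⟩
    obtain ⟨t₀, ht₀, hc₀⟩ := hP
    set Y := y (f (u t₀)) with hY
    have hY0 := hγ Y
    have hYK : Y ∈ K := (hy _ (huK _ ht₀)).2.1
    set v := γ Y + 3 * C * r with hv
    have hv0 : 0 < v := by positivity
    have hmem : ∀ t ∈ Set.Icc 0 T, c (f (u t)) = P →
        |f (u t) - f (u t₀)| ≤ 2 * C * r * v ∧ v ≤ γ (u t) + η := by
      intro t ht hc
      obtain ⟨-, hk, h1, -⟩ := hy _ (huK t ht)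
      obtain ⟨-, -, h1', -⟩ := hy _ (huK t₀ ht₀)
      have h3 := hle _ (huK t ht)
      have hd := hyy _ (huK t₀ ht₀) _ (huK t ht) (hc₀.trans hc.symm)
      have h4 := hvar Y hYK _ hk
      have h5 := hLip Y hYK _ hk
      have hd0 : 0 ≤ dist Y (y (f (u t))) := dist_nonneg
      constructor
      · have h6 : γ Y * dist Y (y (f (u t))) + dist Y (y (f (u t))) ^ 2
            ≤ γ Y * (2 * r) + (2 * r) ^ 2 := by gcongr
        have h7 := mul_le_mul_of_nonneg_left h6 hC0.le
        have e1 := abs_le.1 h1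
        have e2 := abs_le.1 h1'
        have e3 := abs_le.1 (h4.trans h7)
        have h8 : C * (γ Y * (2 * r) + (2 * r) ^ 2) + 2 * r ^ 2 ≤ 2 * C * r * v := by
          rw [hv]
          nlinarith [mul_nonneg (mul_nonneg (sub_nonneg.2 hC) hr.le) hr.le,
            mul_nonneg (mul_nonneg (mul_nonneg (sub_nonneg.2 hC) hC0.le) hr.le) hr.le]
        rw [abs_le]
        constructor <;> linarith [e1.1, e1.2, e2.1, e2.2, e3.1, e3.2]
      · have h9 := (abs_le.1 h5).2
        have h10 := mul_le_mul_of_nonneg_left hd hC0.le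
        nlinarith [mul_nonneg (sub_nonneg.2 hC) hr.le]
    set J : Set ℝ := Set.Icc 0 T ∩ {t | |f (u t) - f (u t₀)| ≤ 2 * C * r * v} with hJ
    have hJc : IsCompact J := by
      refine isCompact_Icc.of_isClosed_subset ?_ Set.inter_subset_left
      exact (hfc.sub continuousOn_const).abs.preimage_isClosed_of_isClosed isClosed_Icc
        (isClosed_Iic (a := 2 * C * r * v))
    have hJ₀ : t₀ ∈ J := ⟨ht₀, (hmem t₀ ht₀ hc₀).1⟩
    obtain ⟨a, haJ, ha⟩ := hJc.exists_isLeast ⟨t₀, hJ₀⟩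
    obtain ⟨b, hbJ, hb⟩ := hJc.exists_isGreatest ⟨t₀, hJ₀⟩
    have hab : a ≤ b := ha hbJ
    have hsub : Set.Icc a b ⊆ Set.Icc 0 T := Set.Icc_subset_Icc haJ.1.1 hbJ.1.2
    have hcont : ContinuousOn (fun t => γ (u t) ^ 2) (Set.Icc 0 T) := hγu.pow 2
    have hint : IntegrableOn (fun t => γ (u t) ^ 2 / v) (Set.Icc 0 T) :=
      (hcont.div_const v).integrableOn_Icc
    refine ⟨(Set.Icc a b).indicator fun t => γ (u t) ^ 2 / v, hint.indicator measurableSet_Icc,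
      fun t => Set.indicator_nonneg (fun t _ => by positivity) t, ?_, fun t ht hc => ?_⟩
    · rw [setIntegral_indicator measurableSet_Icc, Set.inter_eq_right.2 hsub,
        integral_Icc_eq_integral_Ioc, ← intervalIntegral.integral_of_le hab,
        intervalIntegral.integral_div, div_le_iff₀ hv0,
        intervalIntegral.integral_eq_sub_of_hasDerivAt
          (fun t ht => hfu t (hsub (Set.uIcc_of_le hab ▸ ht)))
          ((hcont.mono hsub).intervalIntegrable_of_Icc hab)]
      have h1 := abs_le.1 (show |f (u a) - f (u t₀)| ≤ 2 * C * r * v from haJ.2)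
      have h2 := abs_le.1 (show |f (u b) - f (u t₀)| ≤ 2 * C * r * v from hbJ.2)
      linarith [h1.1, h2.2]
    · obtain ⟨h1, h2⟩ := hmem t ht hc
      have hJt : t ∈ J := ⟨ht, h1⟩
      rw [Set.indicator_of_mem (show t ∈ Set.Icc a b from ⟨ha hJt, hb hJt⟩)]
      gcongr
  choose ψ hψi hψ0 hψle hψge using hψ
  have hsum : ∀ t ∈ Set.Icc 0 T, γ (u t) ≤ ∑ P ∈ Λ, ψ P t + η := by
    intro t ht
    have h1 := hψge _ t ht rfl
    have h2 : ψ (c (f (u t))) t ≤ ∑ P ∈ Λ, ψ P t :=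
      Finset.single_le_sum (f := fun P => ψ P t) (fun P _ => hψ0 P t) (hy _ (huK t ht)).1
    have h3 : γ (u t) ≤ γ (u t) ^ 2 / (γ (u t) + η) + η := by
      have := hγ (u t)
      rw [← sub_le_iff_le_add, le_div_iff₀ (by positivity)]
      nlinarith
    linarith
  have hsi : IntegrableOn (fun t => ∑ P ∈ Λ, ψ P t) (Set.Icc 0 T) :=
    integrable_finsetSum _ fun P _ => hψi P
  have hconst : IntegrableOn (fun _ => η) (Set.Icc 0 T) := continuousOn_const.integrableOn_Icc
  calc ∫ t in Set.Icc 0 T, γ (u t) ≤ ∫ t in Set.Icc 0 T, (∑ P ∈ Λ, ψ P t + η) :=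
        setIntegral_mono_on hγu.integrableOn_Icc (hsi.add hconst) measurableSet_Icc hsum
    _ = ∑ P ∈ Λ, (∫ t in Set.Icc 0 T, ψ P t) + η * T := by
        rw [integral_add hsi hconst, integral_finsetSum _ fun P _ => hψi P]
        simp [hT, mul_comm]
    _ ≤ ∑ P ∈ Λ, 4 * C * r + η * T := by gcongr with P; exact hψle P
    _ ≤ 4 * C * L + η * T := by
        rw [Finset.sum_const, nsmul_eq_mul]
        nlinarith [mul_le_mul_of_nonneg_left hΛ (by positivity : 0 ≤ 4 * C)]

open MvPolynomial

/-- Gradient curves of polynomial data on a compact algebraic set have uniformly bounded length. -/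
theorem exists_length_bound {σ : Type} [Fintype σ] [Nonempty σ] {f g h : MvPolynomial σ ℝ}
    (hg : ∀ y, 0 ≤ eval y g) (hh : ∀ y, 0 ≤ eval y h)
    (hK : Bornology.IsBounded {y : σ → ℝ | eval y h ≤ 1}) {C : ℝ} (hC : 1 ≤ C)
    (hLip : ∀ x, eval x h = 0 → ∀ y, eval y h = 0 →
      |√(eval x g) - √(eval y g)| ≤ C * dist x y)
    (hvar : ∀ x, eval x h = 0 → ∀ y, eval y h = 0 →
      |eval x f - eval y f| ≤ C * (√(eval x g) * dist x y + dist x y ^ 2)) :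
    ∃ L : ℝ, ∀ (u : ℝ → σ → ℝ) (T : ℝ), 0 ≤ T → (∀ t ∈ Set.Icc 0 T, eval (u t) h = 0) →
      ContinuousOn u (Set.Icc 0 T) →
      (∀ t ∈ Set.Icc 0 T, HasDerivAt (fun t => eval (u t) f) (eval (u t) g) t) →
      ∫ t in Set.Icc 0 T, √(eval (u t) g) ≤ L := by
  classical
  obtain ⟨L, hL⟩ := exists_cells (f := f) hg hh hK
  refine ⟨4 * C * L, fun u T hT huK hu hfu => ?_⟩
  have hC0 : 0 < C := by linarith
  refine le_of_forall_pos_le_add fun ε hε => ?_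
  set η := ε / (T + 1) with hη
  have hη0 : 0 < η := by positivity
  have hηT : η * T ≤ ε := by
    rw [hη, div_mul_eq_mul_div, div_le_iff₀ (by positivity)]
    nlinarith
  obtain ⟨Λ, c, y, hΛ, hy, hyy⟩ := hL (min 1 (η / (6 * C))) (by positivity) (min_le_left _ _)
  refine (setIntegral_le_of_cells (K := {x | eval x h = 0}) (f := fun x => eval x f)
    (γ := fun x => √(eval x g)) (η := η) hC
    (fun x => Real.sqrt_nonneg _) hLip hvar (r := min 1 (η / (6 * C))) (by positivity) ?_ hΛ
    (c := c) (y := y) (fun x hx => ?_) (fun x hx x' hx' hc => hyy _ _ ⟨x, hx, rfl⟩ ⟨x', hx', rfl⟩ hc)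
    hT huK ?_ (fun t ht => ?_)).trans (by linarith)
  · have := min_le_right 1 (η / (6 * C))
    rwa [le_div_iff₀ (by positivity), mul_comm] at this
  · obtain ⟨h1, h2, h3, h4⟩ := hy _ ⟨x, hx, rfl⟩
    refine ⟨h1, h2, h3, ?_⟩
    rw [Real.sq_sqrt (hg _), Real.sq_sqrt (hg _)]
    exact h4 x hx rfl
  · exact (g.continuous_eval.comp_continuousOn hu).sqrt
  · rw [Real.sq_sqrt (hg _)]
    exact hfu t ht

end Length

section MatrixEstimates

variable {N : ℕ}

theorem Matrix.norm_mul_le_card (X Y : Matrix (Fin N) (Fin N) ℂ) : ‖X * Y‖ ≤ N * ‖X‖ * ‖Y‖ := by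
  refine (Matrix.norm_le_iff (by positivity)).2 fun i j => ?_
  rw [Matrix.mul_apply]
  refine (norm_sum_le_of_le (n := fun _ => ‖X‖ * ‖Y‖) _ fun l _ => ?_).trans (by simp [mul_assoc])
  rw [norm_mul]
  exact mul_le_mul (Matrix.norm_entry_le_entrywise_sup_norm X)
    (Matrix.norm_entry_le_entrywise_sup_norm Y) (norm_nonneg _) (norm_nonneg _)

theorem Matrix.abs_re_trace_le_card (X : Matrix (Fin N) (Fin N) ℂ) : |X.trace.re| ≤ N * ‖X‖ := by
  refine (Complex.abs_re_le_norm _).trans ?_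
  rw [Matrix.trace]
  refine (norm_sum_le_of_le (n := fun _ => ‖X‖) _ fun l _ => ?_).trans (by simp)
  exact Matrix.norm_entry_le_entrywise_sup_norm X

theorem norm_skewPart_le (X : Matrix (Fin N) (Fin N) ℂ) : ‖skewPart X‖ ≤ ‖X‖ := by
  rw [skewPart, norm_smul]
  have h := norm_sub_le X Xᴴ
  rw [Matrix.norm_conjTranspose] at h
  norm_num
  linarith

theorem skewPart_sub (X Y : Matrix (Fin N) (Fin N) ℂ) :
    skewPart (X - Y) = skewPart X - skewPart Y := by
  simp only [skewPart, conjTranspose_sub, ← smul_sub]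
  congr 1
  abel

theorem conjTranspose_skewPart (X : Matrix (Fin N) (Fin N) ℂ) : (skewPart X)ᴴ = -skewPart X := by
  simp [skewPart, conjTranspose_smul, ← smul_neg]

theorem Matrix.re_trace_conjTranspose (X : Matrix (Fin N) (Fin N) ℂ) :
    Xᴴ.trace.re = X.trace.re := by
  simp [Matrix.trace_conjTranspose]

theorem re_trace_mul_skewPart (E B : Matrix (Fin N) (Fin N) ℂ) :
    (E * skewPart B).trace.re = ((E * B).trace.re - (E * Bᴴ).trace.re) / 2 := by
  simp only [skewPart, Matrix.mul_smul, Matrix.mul_sub, trace_smul, trace_sub, smul_eq_mul]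
  rw [show (1 : ℂ) / 2 = ((1 / 2 : ℝ) : ℂ) by push_cast; rfl, Complex.re_ofReal_mul, Complex.sub_re]
  ring

/-- The sum of the squared absolute values of the entries. -/
noncomputable def frobSq (X : Matrix (Fin N) (Fin N) ℂ) : ℝ := ∑ i, ∑ j, Complex.normSq (X i j)

theorem frobSq_nonneg (X : Matrix (Fin N) (Fin N) ℂ) : 0 ≤ frobSq X :=
  Finset.sum_nonneg fun _ _ => Finset.sum_nonneg fun _ _ => Complex.normSq_nonneg _

theorem normSq_le_frobSq (X : Matrix (Fin N) (Fin N) ℂ) (i j : Fin N) :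
    Complex.normSq (X i j) ≤ frobSq X :=
  (Finset.single_le_sum (f := fun j => Complex.normSq (X i j))
    (fun _ _ => Complex.normSq_nonneg _) (Finset.mem_univ j)).trans
  (Finset.single_le_sum (f := fun i => ∑ j, Complex.normSq (X i j))
    (fun _ _ => Finset.sum_nonneg fun _ _ => Complex.normSq_nonneg _) (Finset.mem_univ i))

theorem frobSq_eq_zero {X : Matrix (Fin N) (Fin N) ℂ} : frobSq X = 0 ↔ X = 0 := by
  refine ⟨fun h => ?_, fun h => by simp [h, frobSq]⟩
  ext i j
  exact Complex.normSq_eq_zero.1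
    (le_antisymm (h ▸ normSq_le_frobSq X i j) (Complex.normSq_nonneg _))

theorem norm_le_sqrt_frobSq (X : Matrix (Fin N) (Fin N) ℂ) : ‖X‖ ≤ √(frobSq X) := by
  refine (Matrix.norm_le_iff (Real.sqrt_nonneg _)).2 fun i j => Real.le_sqrt_of_sq_le ?_
  rw [← Complex.normSq_eq_norm_sq]
  exact normSq_le_frobSq X i j

theorem sqrt_frobSq_eq (X : Matrix (Fin N) (Fin N) ℂ) :
    √(frobSq X) = ‖WithLp.toLp 2 (fun q : Fin N × Fin N => X q.1 q.2)‖ := by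
  rw [EuclideanSpace.norm_eq, Fintype.sum_prod_type]
  simp [frobSq, Complex.normSq_eq_norm_sq]

theorem sqrt_frobSq_le (X : Matrix (Fin N) (Fin N) ℂ) : √(frobSq X) ≤ N * ‖X‖ := by
  refine Real.sqrt_le_iff.2 ⟨by positivity, ?_⟩
  have h : frobSq X ≤ ∑ _i : Fin N, ∑ _j : Fin N, ‖X‖ ^ 2 := by
    refine Finset.sum_le_sum fun i _ => Finset.sum_le_sum fun j _ => ?_
    rw [Complex.normSq_eq_norm_sq]
    gcongr
    exact Matrix.norm_entry_le_entrywise_sup_norm _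
  refine h.trans (le_of_eq ?_)
  simp
  ring

theorem abs_sqrt_frobSq_sub_le (X Y : Matrix (Fin N) (Fin N) ℂ) :
    |√(frobSq X) - √(frobSq Y)| ≤ N * ‖X - Y‖ := by
  refine le_trans ?_ (sqrt_frobSq_le (X - Y))
  rw [sqrt_frobSq_eq, sqrt_frobSq_eq, sqrt_frobSq_eq]
  exact abs_norm_sub_norm_le _ _

theorem re_trace_conjTranspose_mul_self (X : Matrix (Fin N) (Fin N) ℂ) :
    (Xᴴ * X).trace.re = frobSq X := by
  rw [frobSq, Finset.sum_comm]
  simp only [Matrix.trace, Matrix.diag_apply, Matrix.mul_apply, Matrix.conjTranspose_apply,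
    Complex.re_sum]
  refine Finset.sum_congr rfl fun i _ => Finset.sum_congr rfl fun j _ => ?_
  simp [Complex.normSq_apply]

/-- The matrix `([U A U†, C†])_S`. -/
noncomputable def skewGrad (A C U : Matrix (Fin N) (Fin N) ℂ) : Matrix (Fin N) (Fin N) ℂ :=
  skewPart ((U * A * Uᴴ) * Cᴴ - Cᴴ * (U * A * Uᴴ))

/-- The function `Re tr(C† U A U†)`. -/
noncomputable def trObj (A C U : Matrix (Fin N) (Fin N) ℂ) : ℝ := (Cᴴ * (U * A * Uᴴ)).trace.re

theorem norm_skewGrad_sub_le (A C : Matrix (Fin N) (Fin N) ℂ) {U V : Matrix (Fin N) (Fin N) ℂ}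
    (hU : ‖U‖ ≤ 1) (hV : ‖V‖ ≤ 1) :
    ‖skewGrad A C U - skewGrad A C V‖ ≤ 4 * N ^ 3 * ‖A‖ * ‖C‖ * ‖U - V‖ := by
  rw [skewGrad, skewGrad, ← skewPart_sub]
  refine (norm_skewPart_le _).trans ?_
  set X := U * A * Uᴴ - V * A * Vᴴ with hX
  have hX' : X = (U - V) * A * Uᴴ + V * A * (U - V)ᴴ := by
    simp only [hX, conjTranspose_sub]; noncomm_ring
  have h1 : ‖X‖ ≤ 2 * N ^ 2 * ‖A‖ * ‖U - V‖ := by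
    rw [hX']
    refine (norm_add_le _ _).trans ?_
    have a1 : ‖(U - V) * A * Uᴴ‖ ≤ N * (N * ‖U - V‖ * ‖A‖) * 1 := by
      refine (Matrix.norm_mul_le_card _ _).trans ?_
      rw [norm_conjTranspose]
      gcongr
      exact Matrix.norm_mul_le_card _ _
    have a2 : ‖V * A * (U - V)ᴴ‖ ≤ N * (N * 1 * ‖A‖) * ‖U - V‖ := by
      refine (Matrix.norm_mul_le_card _ _).trans ?_
      rw [norm_conjTranspose]
      gcongr
      refine (Matrix.norm_mul_le_card _ _).trans ?_
      gcongr
    linarith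
  have e : U * A * Uᴴ * Cᴴ - Cᴴ * (U * A * Uᴴ) - (V * A * Vᴴ * Cᴴ - Cᴴ * (V * A * Vᴴ))
      = X * Cᴴ - Cᴴ * X := by
    simp only [hX]; noncomm_ring
  rw [e]
  have a1 := Matrix.norm_mul_le_card X Cᴴ
  have a2 := Matrix.norm_mul_le_card Cᴴ X
  rw [norm_conjTranspose] at a1 a2
  have a3 := norm_sub_le (X * Cᴴ) (Cᴴ * X)
  have a4 := mul_le_mul_of_nonneg_left h1 (by positivity : 0 ≤ 2 * N * ‖C‖)
  linarith

/-- Second-order expansion of `Re tr(C† U A U†)` along the unitary group. -/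
theorem trObj_sub_eq (A C : Matrix (Fin N) (Fin N) ℂ) {U V : Matrix (Fin N) (Fin N) ℂ}
    (hU : Uᴴ * U = 1) (hV : Vᴴ * V = 1) {E X B : Matrix (Fin N) (Fin N) ℂ}
    (hE : E = (V - U) * Uᴴ) (hX : X = U * A * Uᴴ) (hB : B = X * Cᴴ - Cᴴ * X) :
    trObj A C V - trObj A C U = (E * skewGrad A C U).trace.re - (B * (E * Eᴴ)).trace.re / 2
      - (Cᴴ * X * (E * Eᴴ)).trace.re + (Cᴴ * E * (X * Eᴴ)).trace.re := by
  have hU' : U * Uᴴ = 1 := mul_eq_one_comm.1 hU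
  have hV' : V * Vᴴ = 1 := mul_eq_one_comm.1 hV
  have hVE : V = U + E * U := by
    rw [hE, Matrix.mul_assoc, hU, mul_one, add_sub_cancel]
  have hEE : Eᴴ = -E - E * Eᴴ := by
    have h : (1 + E) * (1 + E)ᴴ = 1 := by
      have : 1 + E = V * Uᴴ := by rw [hE, sub_mul, hU']; abel
      rw [this, conjTranspose_mul, conjTranspose_conjTranspose, Matrix.mul_assoc,
        ← Matrix.mul_assoc Uᴴ, hU, one_mul, hV']
    rw [conjTranspose_add, conjTranspose_one, mul_add, mul_one, add_mul, one_mul] at h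
    have h2 : Eᴴ = (1 + E + (Eᴴ + E * Eᴴ)) - 1 - E - E * Eᴴ := by abel
    rw [h] at h2
    rw [h2]
    conv_rhs => rw [← h2]
    abel
  have key : ∀ M : Matrix (Fin N) (Fin N) ℂ,
      (M * Eᴴ).trace.re = -(M * E).trace.re - (M * (E * Eᴴ)).trace.re := by
    intro M
    conv_lhs => rw [hEE]
    simp [mul_sub]
  have hV1 : Cᴴ * (V * A * Vᴴ) = Cᴴ * X + Cᴴ * E * X + Cᴴ * X * Eᴴ + Cᴴ * E * (X * Eᴴ) := by
    rw [hVE, hX, conjTranspose_add, conjTranspose_mul]; noncomm_ring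
  have hS : (E * skewGrad A C U).trace.re
      = (E * B).trace.re + (B * (E * Eᴴ)).trace.re / 2 := by
    rw [skewGrad, ← hX, ← hB, re_trace_mul_skewPart]
    have h1 : (E * Bᴴ).trace.re = (B * Eᴴ).trace.re := by
      rw [← Matrix.re_trace_conjTranspose, conjTranspose_mul, conjTranspose_conjTranspose]
    rw [h1, key, Matrix.trace_mul_comm B E]
    ring
  have hEB : (E * B).trace.re = (Cᴴ * E * X).trace.re - (Cᴴ * X * E).trace.re := by
    rw [hB, mul_sub, trace_sub, Complex.sub_re, ← Matrix.mul_assoc, ← Matrix.mul_assoc,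
      Matrix.trace_mul_comm (E * X), Matrix.mul_assoc E, Matrix.trace_mul_comm E, Matrix.mul_assoc Cᴴ E]
  rw [trObj, trObj, ← hX, hV1]
  simp only [trace_add, Complex.add_re]
  rw [key, hS, hEB]
  ring

theorem exists_abs_trObj_sub_le (A C : Matrix (Fin N) (Fin N) ℂ) :
    ∃ c : ℝ, 0 ≤ c ∧ ∀ U V : Matrix (Fin N) (Fin N) ℂ, Uᴴ * U = 1 → Vᴴ * V = 1 →
      |trObj A C U - trObj A C V| ≤
        c * (√(frobSq (skewGrad A C U)) * ‖U - V‖ + ‖U - V‖ ^ 2) := by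
  refine ⟨N ^ 3 + 4 * N ^ 8 * ‖A‖ * ‖C‖, by positivity, fun U V hU hV => ?_⟩
  have nU : ‖U‖ ≤ 1 := entrywise_sup_norm_bound_of_unitary (Matrix.mem_unitaryGroup_iff'.2 hU)
  have h := trObj_sub_eq A C hU hV rfl rfl rfl
  rw [abs_sub_comm, h]
  set E := (V - U) * Uᴴ
  set X := U * A * Uᴴ
  set d := ‖U - V‖
  set γ := √(frobSq (skewGrad A C U))
  have hγ : 0 ≤ γ := Real.sqrt_nonneg _
  have hd : 0 ≤ d := norm_nonneg _
  have nE : ‖E‖ ≤ N * d := by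
    refine (Matrix.norm_mul_le_card _ _).trans ?_
    rw [norm_conjTranspose, norm_sub_rev]
    exact (mul_le_of_le_one_right (by positivity) nU)
  have nX : ‖X‖ ≤ N ^ 2 * ‖A‖ := by
    refine (Matrix.norm_mul_le_card _ _).trans ?_
    rw [norm_conjTranspose]
    refine (mul_le_of_le_one_right (by positivity) nU).trans ?_
    rw [pow_two, mul_assoc]
    gcongr
    refine (Matrix.norm_mul_le_card _ _).trans ?_
    gcongr
    exact mul_le_of_le_one_right (by positivity) nU
  have tr2 : ∀ P Q : Matrix (Fin N) (Fin N) ℂ, |(P * Q).trace.re| ≤ N ^ 2 * (‖P‖ * ‖Q‖) := by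
    intro P Q
    refine (Matrix.abs_re_trace_le_card _).trans ?_
    rw [pow_two, mul_assoc]
    gcongr
    linarith [Matrix.norm_mul_le_card P Q]
  have nEE : ‖E * Eᴴ‖ ≤ N ^ 3 * d ^ 2 := by
    refine (Matrix.norm_mul_le_card _ _).trans ?_
    rw [norm_conjTranspose]
    calc (N : ℝ) * ‖E‖ * ‖E‖ ≤ N * (N * d) * (N * d) := by gcongr
      _ = N ^ 3 * d ^ 2 := by ring
  have nCX : ‖Cᴴ * X‖ ≤ N ^ 3 * ‖A‖ * ‖C‖ := by
    refine (Matrix.norm_mul_le_card _ _).trans ?_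
    rw [norm_conjTranspose]
    calc (N : ℝ) * ‖C‖ * ‖X‖ ≤ N * ‖C‖ * (N ^ 2 * ‖A‖) := by gcongr
      _ = _ := by ring
  have nXC : ‖X * Cᴴ‖ ≤ N ^ 3 * ‖A‖ * ‖C‖ := by
    refine (Matrix.norm_mul_le_card _ _).trans ?_
    rw [norm_conjTranspose]
    calc (N : ℝ) * ‖X‖ * ‖C‖ ≤ N * (N ^ 2 * ‖A‖) * ‖C‖ := by gcongr
      _ = _ := by ring
  have nCE : ‖Cᴴ * E‖ ≤ N ^ 2 * ‖C‖ * d := by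
    refine (Matrix.norm_mul_le_card _ _).trans ?_
    rw [norm_conjTranspose]
    calc (N : ℝ) * ‖C‖ * ‖E‖ ≤ N * ‖C‖ * (N * d) := by gcongr
      _ = _ := by ring
  have nXE : ‖X * Eᴴ‖ ≤ N ^ 4 * ‖A‖ * d := by
    refine (Matrix.norm_mul_le_card _ _).trans ?_
    rw [norm_conjTranspose]
    calc (N : ℝ) * ‖X‖ * ‖E‖ ≤ N * (N ^ 2 * ‖A‖) * (N * d) := by gcongr
      _ = _ := by ring
  have nB : ‖X * Cᴴ - Cᴴ * X‖ ≤ 2 * (N ^ 3 * ‖A‖ * ‖C‖) := by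
    linarith [norm_sub_le (X * Cᴴ) (Cᴴ * X)]
  have t1 : |(E * skewGrad A C U).trace.re| ≤ N ^ 3 * (γ * d) :=
    calc _ ≤ _ := tr2 _ _
      _ ≤ N ^ 2 * ((N * d) * γ) := by
        gcongr
        exact norm_le_sqrt_frobSq _
      _ = _ := by ring
  set q := (N : ℝ) ^ 8 * ‖A‖ * ‖C‖ * d ^ 2 with hq
  have t2 : |((X * Cᴴ - Cᴴ * X) * (E * Eᴴ)).trace.re| ≤ 2 * q :=
    calc _ ≤ _ := tr2 _ _
      _ ≤ N ^ 2 * (2 * (N ^ 3 * ‖A‖ * ‖C‖) * (N ^ 3 * d ^ 2)) := by gcongr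
      _ = _ := by rw [hq]; ring
  have t3 : |(Cᴴ * X * (E * Eᴴ)).trace.re| ≤ q :=
    calc _ ≤ _ := tr2 _ _
      _ ≤ N ^ 2 * ((N ^ 3 * ‖A‖ * ‖C‖) * (N ^ 3 * d ^ 2)) := by gcongr
      _ = _ := by rw [hq]; ring
  have t4 : |(Cᴴ * E * (X * Eᴴ)).trace.re| ≤ q :=
    calc _ ≤ _ := tr2 _ _
      _ ≤ N ^ 2 * ((N ^ 2 * ‖C‖ * d) * (N ^ 4 * ‖A‖ * d)) := by gcongr
      _ = _ := by rw [hq]; ring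
  have t5 : 0 ≤ (N : ℝ) ^ 3 * d ^ 2 := by positivity
  have t6 : 0 ≤ 4 * (N : ℝ) ^ 8 * ‖A‖ * ‖C‖ * (γ * d) := by positivity
  have t7 : (N ^ 3 + 4 * N ^ 8 * ‖A‖ * ‖C‖) * (γ * d + d ^ 2) =
      N ^ 3 * (γ * d) + N ^ 3 * d ^ 2 + 4 * N ^ 8 * ‖A‖ * ‖C‖ * (γ * d) + 4 * q := by
    rw [hq]; ring
  rw [t7]
  rw [abs_le] at t1 t2 t3 t4 ⊢
  constructor <;> linarith [t1.1, t1.2, t2.1, t2.2, t3.1, t3.2, t4.1, t4.2]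

end MatrixEstimates

section PolynomialCoordinates

/-- `F` is a real polynomial function of the coordinates. -/
def IsPolyFun {σ : Type} (F : (σ → ℝ) → ℝ) : Prop :=
  ∃ P : MvPolynomial σ ℝ, ∀ y, MvPolynomial.eval y P = F y

/-- The entries of the matrix-valued function `F` have polynomial real and imaginary parts. -/
def IsPolyMat {σ : Type} {N : ℕ} (F : (σ → ℝ) → Matrix (Fin N) (Fin N) ℂ) : Prop :=
  ∀ i j, IsPolyFun (fun y => (F y i j).re) ∧ IsPolyFun (fun y => (F y i j).im)

variable {σ : Type} {N : ℕ}

theorem IsPolyFun.const (a : ℝ) : IsPolyFun fun _ : σ → ℝ => a := ⟨MvPolynomial.C a, by simp⟩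

theorem IsPolyFun.coord (i : σ) : IsPolyFun fun y : σ → ℝ => y i := ⟨MvPolynomial.X i, by simp⟩

theorem IsPolyFun.add {F G : (σ → ℝ) → ℝ} : IsPolyFun F → IsPolyFun G →
    IsPolyFun fun y => F y + G y :=
  fun ⟨P, hP⟩ ⟨Q, hQ⟩ => ⟨P + Q, fun y => by rw [map_add, hP, hQ]⟩

theorem IsPolyFun.sub {F G : (σ → ℝ) → ℝ} : IsPolyFun F → IsPolyFun G →
    IsPolyFun fun y => F y - G y :=
  fun ⟨P, hP⟩ ⟨Q, hQ⟩ => ⟨P - Q, fun y => by rw [map_sub, hP, hQ]⟩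

theorem IsPolyFun.mul {F G : (σ → ℝ) → ℝ} : IsPolyFun F → IsPolyFun G →
    IsPolyFun fun y => F y * G y :=
  fun ⟨P, hP⟩ ⟨Q, hQ⟩ => ⟨P * Q, fun y => by rw [map_mul, hP, hQ]⟩

theorem IsPolyFun.neg {F : (σ → ℝ) → ℝ} : IsPolyFun F → IsPolyFun fun y => -F y :=
  fun ⟨P, hP⟩ => ⟨-P, fun y => by rw [map_neg, hP]⟩

theorem IsPolyFun.sum {ι : Type} (s : Finset ι) {F : ι → (σ → ℝ) → ℝ}
    (h : ∀ i ∈ s, IsPolyFun (F i)) : IsPolyFun fun y => ∑ i ∈ s, F i y := by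
  classical
  induction s using Finset.induction_on with
  | empty => simpa using IsPolyFun.const 0
  | insert a s ha ih =>
    simp only [Finset.sum_insert ha]
    exact (h a (Finset.mem_insert_self _ _)).add (ih fun i hi => h i (Finset.mem_insert_of_mem hi))

theorem IsPolyMat.const (M : Matrix (Fin N) (Fin N) ℂ) : IsPolyMat fun _ : σ → ℝ => M :=
  fun _ _ => ⟨.const _, .const _⟩

theorem IsPolyMat.sub {F G : (σ → ℝ) → Matrix (Fin N) (Fin N) ℂ} (hF : IsPolyMat F)
    (hG : IsPolyMat G) : IsPolyMat fun y => F y - G y := fun i j => by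
  simp only [Matrix.sub_apply, Complex.sub_re, Complex.sub_im]
  exact ⟨(hF i j).1.sub (hG i j).1, (hF i j).2.sub (hG i j).2⟩

theorem IsPolyMat.mul {F G : (σ → ℝ) → Matrix (Fin N) (Fin N) ℂ} (hF : IsPolyMat F)
    (hG : IsPolyMat G) : IsPolyMat fun y => F y * G y := fun i j => by
  simp only [Matrix.mul_apply, Complex.re_sum, Complex.im_sum, Complex.mul_re, Complex.mul_im]
  exact ⟨.sum _ fun l _ => ((hF i l).1.mul (hG l j).1).sub ((hF i l).2.mul (hG l j).2),
    .sum _ fun l _ => ((hF i l).1.mul (hG l j).2).add ((hF i l).2.mul (hG l j).1)⟩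

theorem IsPolyMat.conjTranspose {F : (σ → ℝ) → Matrix (Fin N) (Fin N) ℂ} (hF : IsPolyMat F) :
    IsPolyMat fun y => (F y)ᴴ := fun i j => by
  simp only [Matrix.conjTranspose_apply, Complex.star_def, Complex.conj_re, Complex.conj_im]
  exact ⟨(hF j i).1, (hF j i).2.neg⟩

theorem IsPolyMat.skewPart {F : (σ → ℝ) → Matrix (Fin N) (Fin N) ℂ} (hF : IsPolyMat F) :
    IsPolyMat fun y => skewPart (F y) := by
  have h : (fun y => _root_.skewPart (F y))
      = fun y => (((1 : ℂ) / 2) • (1 : Matrix (Fin N) (Fin N) ℂ)) * (F y - (F y)ᴴ) := by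
    funext y
    simp [_root_.skewPart]
  rw [h]
  exact (IsPolyMat.const _).mul (hF.sub hF.conjTranspose)

theorem IsPolyMat.re_trace {F : (σ → ℝ) → Matrix (Fin N) (Fin N) ℂ} (hF : IsPolyMat F) :
    IsPolyFun fun y => (F y).trace.re := by
  simp only [Matrix.trace, Complex.re_sum, Matrix.diag_apply]
  exact .sum _ fun i _ => (hF i i).1

theorem IsPolyMat.frobSq {F : (σ → ℝ) → Matrix (Fin N) (Fin N) ℂ} (hF : IsPolyMat F) :
    IsPolyFun fun y => frobSq (F y) := by
  simp only [_root_.frobSq, Complex.normSq_apply]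
  exact .sum _ fun i _ => .sum _ fun j _ => ((hF i j).1.mul (hF i j).1).add
    ((hF i j).2.mul (hF i j).2)

/-- The complex matrix with the given real and imaginary parts. -/
def matOfCoords (y : Fin N × Fin N × Bool → ℝ) : Matrix (Fin N) (Fin N) ℂ :=
  Matrix.of fun i j => ⟨y (i, j, false), y (i, j, true)⟩

/-- The real and imaginary parts of the entries of a complex matrix. -/
def coordsOfMat (U : Matrix (Fin N) (Fin N) ℂ) : Fin N × Fin N × Bool → ℝ :=
  fun q => cond q.2.2 (U q.1 q.2.1).im (U q.1 q.2.1).re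

theorem matOfCoords_coordsOfMat (U : Matrix (Fin N) (Fin N) ℂ) :
    matOfCoords (coordsOfMat U) = U := rfl

theorem isPolyMat_matOfCoords : IsPolyMat (matOfCoords (N := N)) :=
  fun i j => ⟨.coord (i, j, false), .coord (i, j, true)⟩

theorem continuous_coordsOfMat : Continuous (coordsOfMat (N := N)) := by
  refine continuous_pi fun q => ?_
  have h : Continuous fun U : Matrix (Fin N) (Fin N) ℂ => U q.1 q.2.1 :=
    (continuous_apply q.2.1).comp (continuous_apply q.1)
  obtain ⟨i, j, b⟩ := q
  cases b
  · exact Complex.continuous_re.comp h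
  · exact Complex.continuous_im.comp h

theorem norm_matOfCoords_sub_le (x y : Fin N × Fin N × Bool → ℝ) :
    ‖matOfCoords x - matOfCoords y‖ ≤ 2 * dist x y := by
  refine (Matrix.norm_le_iff (by positivity)).2 fun i j => ?_
  refine (Complex.norm_le_abs_re_add_abs_im _).trans ?_
  have h1 := dist_le_pi_dist x y (i, j, false)
  have h2 := dist_le_pi_dist x y (i, j, true)
  rw [Real.dist_eq] at h1 h2
  simp only [matOfCoords, Matrix.sub_apply, Matrix.of_apply, Complex.sub_re, Complex.sub_im]
  linarith

theorem abs_le_norm_matOfCoords (y : Fin N × Fin N × Bool → ℝ) (i j : Fin N) (b : Bool) :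
    |y (i, j, b)| ≤ ‖matOfCoords y i j‖ := by
  cases b
  · exact Complex.abs_re_le_norm (matOfCoords y i j)
  · exact Complex.abs_im_le_norm (matOfCoords y i j)

theorem norm_entry_le_of_frobSq_le {U : Matrix (Fin N) (Fin N) ℂ} (h : frobSq (Uᴴ * U - 1) ≤ 1)
    (i j : Fin N) : ‖U i j‖ ≤ 2 := by
  have h1 := (normSq_le_frobSq (Uᴴ * U - 1) j j).trans h
  have h2 : ‖(Uᴴ * U - 1) j j‖ ≤ 1 := by
    rw [Complex.normSq_eq_norm_sq] at h1
    exact (sq_le_one_iff₀ (norm_nonneg _)).1 h1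
  have h3 := (Complex.re_le_norm _).trans h2
  have h4 : ((Uᴴ * U - 1) j j).re = ∑ l, ‖U l j‖ ^ 2 - 1 := by
    simp only [Matrix.sub_apply, Matrix.mul_apply, Matrix.one_apply_eq, Complex.sub_re,
      Complex.re_sum, Complex.one_re, Matrix.conjTranspose_apply]
    congr 1
    refine Finset.sum_congr rfl fun l _ => ?_
    rw [← Complex.normSq_eq_norm_sq, Complex.normSq_apply]
    simp
  have h5 : ‖U i j‖ ^ 2 ≤ ∑ l, ‖U l j‖ ^ 2 :=
    Finset.single_le_sum (f := fun l => ‖U l j‖ ^ 2) (fun l _ => by positivity)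
    (Finset.mem_univ i)
  nlinarith [norm_nonneg (U i j)]

/-- Ascent curves of `Re tr(C† U A U†)` on the unitary group have uniformly bounded length. -/
theorem exists_integral_sqrt_frobSq_le (hN : 1 ≤ N) (A C : Matrix (Fin N) (Fin N) ℂ) :
    ∃ L : ℝ, ∀ (U : ℝ → Matrix (Fin N) (Fin N) ℂ) (T : ℝ), 0 ≤ T →
      (∀ t ∈ Set.Icc 0 T, (U t)ᴴ * U t = 1) → ContinuousOn U (Set.Icc 0 T) →
      (∀ t ∈ Set.Icc 0 T,
        HasDerivAt (fun t => trObj A C (U t)) (frobSq (skewGrad A C (U t))) t) →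
      ∫ t in Set.Icc 0 T, √(frobSq (skewGrad A C (U t))) ≤ L := by
  have hM := isPolyMat_matOfCoords (N := N)
  have hX := (hM.mul (.const A)).mul hM.conjTranspose
  obtain ⟨f, hf⟩ := ((IsPolyMat.const Cᴴ).mul hX).re_trace
  obtain ⟨g, hg⟩ := ((hX.mul (.const Cᴴ)).sub ((IsPolyMat.const Cᴴ).mul hX)).skewPart.frobSq
  obtain ⟨h, hh⟩ := ((hM.conjTranspose.mul hM).sub (.const 1)).frobSq
  have hf' : ∀ y, MvPolynomial.eval y f = trObj A C (matOfCoords y) := hf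
  have hg' : ∀ y, MvPolynomial.eval y g = frobSq (skewGrad A C (matOfCoords y)) := hg
  have hz : ∀ y, MvPolynomial.eval y h = 0 ↔ (matOfCoords y)ᴴ * matOfCoords y = 1 := fun y => by
    rw [hh, frobSq_eq_zero, sub_eq_zero]
  have hnorm : ∀ y, MvPolynomial.eval y h = 0 → ‖matOfCoords y‖ ≤ 1 := fun y hy =>
    entrywise_sup_norm_bound_of_unitary (Matrix.mem_unitaryGroup_iff'.2 ((hz y).1 hy))
  have : Nonempty (Fin N × Fin N × Bool) := ⟨(⟨0, hN⟩, ⟨0, hN⟩, false)⟩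
  have hbdd : Bornology.IsBounded {y | MvPolynomial.eval y h ≤ 1} := by
    refine isBounded_iff_forall_norm_le.2 ⟨2, fun y hy => ?_⟩
    have hy' : frobSq ((matOfCoords y)ᴴ * matOfCoords y - 1) ≤ 1 := (hh y).symm.trans_le hy
    refine (pi_norm_le_iff_of_nonneg zero_le_two).2 fun q => ?_
    exact (abs_le_norm_matOfCoords y q.1 q.2.1 q.2.2).trans (norm_entry_le_of_frobSq_le hy' _ _)
  obtain ⟨c, hc, hvar⟩ := exists_abs_trObj_sub_le A C
  have ha : 0 ≤ 8 * (N : ℝ) ^ 4 * ‖A‖ * ‖C‖ := by positivity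
  have hlip' : ∀ x, MvPolynomial.eval x h = 0 → ∀ y, MvPolynomial.eval y h = 0 →
      |√(MvPolynomial.eval x g) - √(MvPolynomial.eval y g)| ≤
        (1 + 4 * c + 8 * N ^ 4 * ‖A‖ * ‖C‖) * dist x y := by
    intro x hx y hy
    rw [hg', hg']
    have h1 := abs_sqrt_frobSq_sub_le (skewGrad A C (matOfCoords x)) (skewGrad A C (matOfCoords y))
    have h2 := norm_skewGrad_sub_le A C (hnorm x hx) (hnorm y hy)
    have h3 := norm_matOfCoords_sub_le x y
    calc _ ≤ _ := h1
      _ ≤ N * (4 * N ^ 3 * ‖A‖ * ‖C‖ * (2 * dist x y)) := by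
        gcongr
        exact h2.trans (by gcongr)
      _ = 8 * N ^ 4 * ‖A‖ * ‖C‖ * dist x y := by ring
      _ ≤ _ := by gcongr; linarith
  have hvar' : ∀ x, MvPolynomial.eval x h = 0 → ∀ y, MvPolynomial.eval y h = 0 →
      |MvPolynomial.eval x f - MvPolynomial.eval y f| ≤ (1 + 4 * c + 8 * N ^ 4 * ‖A‖ * ‖C‖) *
        (√(MvPolynomial.eval x g) * dist x y + dist x y ^ 2) := by
    intro x hx y hy
    rw [hf', hf', hg']
    have h3 := norm_matOfCoords_sub_le x y
    set γ := √(frobSq (skewGrad A C (matOfCoords x)))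
    have hγ : 0 ≤ γ := Real.sqrt_nonneg _
    have hd : 0 ≤ dist x y := dist_nonneg
    calc _ ≤ _ := hvar _ _ ((hz x).1 hx) ((hz y).1 hy)
      _ ≤ c * (γ * (2 * dist x y) + (2 * dist x y) ^ 2) := by gcongr
      _ ≤ 4 * c * (γ * dist x y + dist x y ^ 2) := by
        nlinarith [mul_nonneg hc (mul_nonneg hγ hd)]
      _ ≤ _ := by gcongr; linarith
  obtain ⟨L, hL⟩ := exists_length_bound (fun y => hg y ▸ frobSq_nonneg _)
    (fun y => hh y ▸ frobSq_nonneg _) hbdd (by linarith) hlip' hvar'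
  refine ⟨L, fun U T hT hU hUc hUd => ?_⟩
  have := hL (fun t => coordsOfMat (U t)) T hT
    (fun t ht => (hz _).2 (by rw [matOfCoords_coordsOfMat]; exact hU t ht))
    (continuous_coordsOfMat.comp_continuousOn hUc) (fun t ht => by
      simpa only [hf', hg', matOfCoords_coordsOfMat] using hUd t ht)
  simpa only [hg', matOfCoords_coordsOfMat] using this

end PolynomialCoordinates

section MatrixCurves

variable {N : ℕ}

theorem hasDerivAt_matrix_iff {U : ℝ → Matrix (Fin N) (Fin N) ℂ} {U' : Matrix (Fin N) (Fin N) ℂ}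
    {t : ℝ} : HasDerivAt U U' t ↔ ∀ i j, HasDerivAt (fun t => U t i j) (U' i j) t :=
  (hasDerivAt_pi (φ := U)).trans (forall_congr' fun i => hasDerivAt_pi (φ := fun t => U t i))

theorem HasDerivAt.matrixMul {U V : ℝ → Matrix (Fin N) (Fin N) ℂ}
    {U' V' : Matrix (Fin N) (Fin N) ℂ} {t : ℝ} (hU : HasDerivAt U U' t) (hV : HasDerivAt V V' t) :
    HasDerivAt (fun t => U t * V t) (U' * V t + U t * V') t := by
  rw [hasDerivAt_matrix_iff] at hU hV ⊢
  intro i j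
  simp only [Matrix.add_apply, Matrix.mul_apply, ← Finset.sum_add_distrib]
  exact HasDerivAt.fun_sum fun l _ => (hU i l).fun_mul (hV l j)

theorem HasDerivAt.matrixConjTranspose {U : ℝ → Matrix (Fin N) (Fin N) ℂ}
    {U' : Matrix (Fin N) (Fin N) ℂ} {t : ℝ} (hU : HasDerivAt U U' t) :
    HasDerivAt (fun t => (U t)ᴴ) U'ᴴ t := by
  rw [hasDerivAt_matrix_iff] at hU ⊢
  exact fun i j => (hU j i).star

theorem HasDerivAt.matrixReTrace {U : ℝ → Matrix (Fin N) (Fin N) ℂ}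
    {U' : Matrix (Fin N) (Fin N) ℂ} {t : ℝ} (hU : HasDerivAt U U' t) :
    HasDerivAt (fun t => (U t).trace.re) U'.trace.re t := by
  rw [hasDerivAt_matrix_iff] at hU
  exact Complex.reCLM.hasFDerivAt.comp_hasDerivAt t
    (HasDerivAt.fun_sum (u := Finset.univ) fun i _ => hU i i)

theorem HasDerivAt.matrixDet {U : ℝ → Matrix (Fin N) (Fin N) ℂ}
    {U' : Matrix (Fin N) (Fin N) ℂ} {t : ℝ} (hU : HasDerivAt U U' t) :
    HasDerivAt (fun t => (U t).det) ((U t).adjugate * U').trace t := by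
  rw [hasDerivAt_matrix_iff] at hU
  have h1 : ((U t).adjugate * U').trace = ∑ i, ((U t).updateCol i fun l => U' l i).det := by
    refine Finset.sum_congr rfl fun i _ => ?_
    rw [← Matrix.cramer_apply, Matrix.cramer_eq_adjugate_mulVec]
    rfl
  have h2 : ((U t).adjugate * U').trace = ∑ τ : Equiv.Perm (Fin N), ((Equiv.Perm.sign τ : ℤ) : ℂ) *
      ∑ i, (∏ j ∈ Finset.univ.erase i, U t (τ j) j) • U' (τ i) i := by
    simp only [h1, Matrix.det_apply', Finset.mul_sum]
    rw [Finset.sum_comm]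
    refine Finset.sum_congr rfl fun τ _ => Finset.sum_congr rfl fun i _ => ?_
    rw [← Finset.mul_prod_erase _ _ (Finset.mem_univ i), Matrix.updateCol_self, smul_eq_mul,
      mul_comm (U' (τ i) i)]
    congr 2
    refine Finset.prod_congr rfl fun j hj => ?_
    rw [Matrix.updateCol_ne (Finset.ne_of_mem_erase hj)]
  rw [h2]
  simp only [Matrix.det_apply']
  exact HasDerivAt.fun_sum fun τ _ =>
    (HasDerivAt.fun_finsetProd fun j _ => hU (τ j) j).const_mul _

end MatrixCurves

section GradientFlow

variable {N : ℕ} {A C : Matrix (Fin N) (Fin N) ℂ} {U : ℝ → Matrix (Fin N) (Fin N) ℂ}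

theorem conjTranspose_skewGrad (A C U : Matrix (Fin N) (Fin N) ℂ) :
    (skewGrad A C U)ᴴ = -skewGrad A C U := conjTranspose_skewPart _

theorem trace_skewGrad (A C U : Matrix (Fin N) (Fin N) ℂ) : (skewGrad A C U).trace = 0 := by
  rw [skewGrad, skewPart, trace_smul, trace_sub, trace_conjTranspose, trace_sub,
    Matrix.trace_mul_comm Cᴴ]
  simp

theorem eq_of_hasDerivAt_zero {E : Type*} [NormedAddCommGroup E] [NormedSpace ℝ E] {F : ℝ → E}
    (hF : ∀ t, 0 ≤ t → HasDerivAt F 0 t) {t : ℝ} (ht : 0 ≤ t) : F t = F 0 :=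
  constant_of_derivWithin_zero
    (fun s hs => (hF s hs.1).differentiableAt.differentiableWithinAt)
    (fun s hs => (hF s hs.1).hasDerivWithinAt.derivWithin
      (uniqueDiffOn_Icc (hs.1.trans_lt hs.2) s ⟨hs.1, hs.2.le⟩)) t ⟨ht, le_rfl⟩

theorem conjTranspose_mul_self_of_flow (hU0 : (U 0)ᴴ * U 0 = 1)
    (hode : ∀ t, 0 ≤ t → HasDerivAt U (-(skewGrad A C (U t) * U t)) t) {t : ℝ} (ht : 0 ≤ t) :
    (U t)ᴴ * U t = 1 := by
  rw [← hU0]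
  refine eq_of_hasDerivAt_zero (F := fun t => (U t)ᴴ * U t) (fun s hs => ?_) ht
  refine ((hode s hs).matrixConjTranspose.matrixMul (hode s hs)).congr_deriv ?_
  rw [conjTranspose_neg, conjTranspose_mul, conjTranspose_skewGrad]
  noncomm_ring

theorem det_of_flow (hode : ∀ t, 0 ≤ t → HasDerivAt U (-(skewGrad A C (U t) * U t)) t) {t : ℝ}
    (ht : 0 ≤ t) : (U t).det = (U 0).det := by
  refine eq_of_hasDerivAt_zero (F := fun t => (U t).det) (fun s hs => ?_) ht
  refine (hode s hs).matrixDet.congr_deriv ?_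
  rw [mul_neg, trace_neg, Matrix.trace_mul_comm, Matrix.mul_assoc, Matrix.mul_adjugate,
    Matrix.mul_smul, mul_one, trace_smul, trace_skewGrad]
  simp

theorem hasDerivAt_trObj_of_flow
    (hode : ∀ t, 0 ≤ t → HasDerivAt U (-(skewGrad A C (U t) * U t)) t) {t : ℝ} (ht : 0 ≤ t) :
    HasDerivAt (fun t => trObj A C (U t)) (frobSq (skewGrad A C (U t))) t := by
  have h := hode t ht
  have hd := ((hasDerivAt_const t Cᴴ).matrixMul
    ((h.matrixMul (hasDerivAt_const t A)).matrixMul h.matrixConjTranspose)).matrixReTrace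
  refine hd.congr_deriv ?_
  set S := skewGrad A C (U t) with hS
  set X := U t * A * (U t)ᴴ with hX
  set B := X * Cᴴ - Cᴴ * X with hB
  have hSh : Sᴴ = -S := conjTranspose_skewGrad _ _ _
  have h1 : (0 * X + Cᴴ * ((-(S * U t) * A + U t * 0) * (U t)ᴴ + U t * A * (-(S * U t))ᴴ)).trace.re
      = -(S * B).trace.re := by
    have e : 0 * X + Cᴴ * ((-(S * U t) * A + U t * 0) * (U t)ᴴ + U t * A * (-(S * U t))ᴴ)
        = Cᴴ * X * S - Cᴴ * S * X := by
      rw [conjTranspose_neg, conjTranspose_mul, hSh, hX]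
      noncomm_ring
    have e2 : (Cᴴ * S * X).trace = (S * (X * Cᴴ)).trace := by
      rw [Matrix.mul_assoc, Matrix.trace_mul_comm, Matrix.mul_assoc]
    rw [e, hB, mul_sub, trace_sub, trace_sub, e2, Matrix.trace_mul_comm (Cᴴ * X)]
    simp
  rw [h1, ← re_trace_conjTranspose_mul_self, hSh, neg_mul, trace_neg, Complex.neg_re]
  have h2 : (S * S).trace.re = ((S * B).trace.re - (S * Bᴴ).trace.re) / 2 :=
    re_trace_mul_skewPart S B
  have h3 : (S * Bᴴ).trace.re = -(S * B).trace.re := by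
    rw [← Matrix.re_trace_conjTranspose, conjTranspose_mul, conjTranspose_conjTranspose, hSh,
      mul_neg, trace_neg, Complex.neg_re, Matrix.trace_mul_comm]
  rw [h2, h3]
  ring

theorem continuous_skewGrad (A C : Matrix (Fin N) (Fin N) ℂ) : Continuous (skewGrad A C) := by
  have h : Continuous fun U => U * A * Uᴴ :=
    (continuous_id.matrix_mul continuous_const).matrix_mul continuous_id.matrix_conjTranspose
  have h1 : Continuous fun U => U * A * Uᴴ * Cᴴ - Cᴴ * (U * A * Uᴴ) :=
    (h.matrix_mul continuous_const).sub (continuous_const.matrix_mul h)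
  exact (h1.sub h1.matrix_conjTranspose).const_smul ((1 : ℂ) / 2)

open MeasureTheory in
theorem exists_tendsto_of_flow (hN : 1 ≤ N) (hU0 : (U 0)ᴴ * U 0 = 1)
    (hode : ∀ t, 0 ≤ t → HasDerivAt U (-(skewGrad A C (U t) * U t)) t) :
    ∃ V, Tendsto U atTop (𝓝 V) ∧ skewGrad A C V = 0 := by
  obtain ⟨L, hL⟩ := exists_integral_sqrt_frobSq_le hN A C
  have hunit := fun t (ht : 0 ≤ t) => conjTranspose_mul_self_of_flow hU0 hode ht
  have hUc : ContinuousOn U (Set.Ici 0) := fun t ht => (hode t ht).continuousAt.continuousWithinAt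
  have hfrob : Continuous (frobSq (N := N)) := by
    unfold frobSq
    exact continuous_finsetSum _ fun i _ => continuous_finsetSum _ fun j _ =>
      Complex.continuous_normSq.comp ((continuous_apply j).comp (continuous_apply i))
  have hγc : Continuous fun V => √(frobSq (skewGrad A C V)) :=
    (hfrob.comp (continuous_skewGrad A C)).sqrt
  have hU'c : ContinuousOn (fun t => -(skewGrad A C (U t) * U t)) (Set.Ici 0) :=
    (((continuous_skewGrad A C).comp_continuousOn hUc).mul hUc).neg
  have hγint : IntegrableOn (fun t => √(frobSq (skewGrad A C (U t)))) (Set.Ioi 0) := by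
    refine integrableOn_Ioi_of_intervalIntegral_norm_bounded L 0 (b := fun T : ℝ => T) (l := atTop)
      (fun T => ?_) tendsto_id ?_
    · exact (((hγc.comp_continuousOn hUc).mono Set.Icc_subset_Ici_self).integrableOn_Icc).mono_set
        Set.Ioc_subset_Icc_self
    · filter_upwards [eventually_ge_atTop 0] with T hT
      rw [intervalIntegral.integral_of_le hT, ← integral_Icc_eq_integral_Ioc]
      simp only [Real.norm_of_nonneg (Real.sqrt_nonneg _)]
      exact hL U T hT (fun t ht => hunit t ht.1) (hUc.mono Set.Icc_subset_Ici_self)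
        fun t ht => hasDerivAt_trObj_of_flow hode ht.1
  have hentry : ∀ i j, ∃ v, Tendsto (fun t => U t i j) atTop (𝓝 v) := fun i j => by
    refine ⟨_, tendsto_limUnder_of_hasDerivAt_of_integrableOn_Ioi (a := 0)
      (fun t ht => hasDerivAt_matrix_iff.1 (hode t (le_of_lt ht)) i j) ?_⟩
    refine (hγint.const_mul N).mono' ((((continuous_apply_apply i j).comp_continuousOn hU'c).mono
      Set.Ioi_subset_Ici_self).aestronglyMeasurable measurableSet_Ioi) ?_
    filter_upwards [ae_restrict_mem measurableSet_Ioi] with t ht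
    have hn : ‖U t‖ ≤ 1 := entrywise_sup_norm_bound_of_unitary
      (Matrix.mem_unitaryGroup_iff'.2 (hunit t (le_of_lt ht)))
    rw [Matrix.neg_apply, norm_neg]
    refine (Matrix.norm_entry_le_entrywise_sup_norm _).trans
      ((Matrix.norm_mul_le_card _ _).trans ((mul_le_of_le_one_right (by positivity) hn).trans ?_))
    gcongr
    exact norm_le_sqrt_frobSq _
  choose V hV using hentry
  have hlim : Tendsto U atTop (𝓝 (Matrix.of V)) :=
    tendsto_pi_nhds.2 fun i => tendsto_pi_nhds.2 fun j => hV i j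
  refine ⟨Matrix.of V, hlim, ?_⟩
  have hγlim : Tendsto (fun t => √(frobSq (skewGrad A C (U t)))) atTop
      (𝓝 √(frobSq (skewGrad A C (Matrix.of V)))) := (hγc.tendsto _).comp hlim
  have h0 : √(frobSq (skewGrad A C (Matrix.of V))) = 0 := by
    refine IntegrableAtFilter.eq_zero_of_tendsto (μ := volume)
      ⟨Set.Ioi 0, Ioi_mem_atTop 0, hγint⟩ (fun s hs => ?_) hγlim
    obtain ⟨b, hb⟩ := mem_atTop_sets.1 hs
    rw [← top_le_iff, ← Real.volume_Ici (a := b)]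
    exact measure_mono hb
  exact frobSq_eq_zero.1 ((Real.sqrt_eq_zero (frobSq_nonneg _)).1 h0)

end GradientFlow

/-- Any solution of the gradient system `U' = −([U A U†, C†])_S · U` starting in `SU(N)`
stays in `SU(N)`, increases `t ↦ Re tr(C† U A U†)` monotonically, and converges as
`t → ∞` to a critical point `U∞ ∈ SU(N)` of `f₁(U) = Re tr(C† U A U†)`, i.e. to a point
with `([U∞ A U∞†, C†])_S = 0`. -/
theorem stmt2 (N : ℕ) (hN : 1 ≤ N) (A C : Matrix (Fin N) (Fin N) ℂ)
    (U : ℝ → Matrix (Fin N) (Fin N) ℂ)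
    (hU0 : U 0 ∈ Matrix.specialUnitaryGroup (Fin N) ℂ)
    (hode : ∀ t : ℝ, 0 ≤ t →
      HasDerivAt U
        (-(skewPart ((U t * A * (U t)ᴴ) * Cᴴ - Cᴴ * (U t * A * (U t)ᴴ)) * U t)) t) :
    (∀ t : ℝ, 0 ≤ t → U t ∈ Matrix.specialUnitaryGroup (Fin N) ℂ) ∧
    MonotoneOn (fun t : ℝ => ((Cᴴ * (U t * A * (U t)ᴴ)).trace).re) (Set.Ici (0 : ℝ)) ∧
    ∃ Ulim ∈ Matrix.specialUnitaryGroup (Fin N) ℂ,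
      Tendsto U atTop (𝓝 Ulim) ∧
      skewPart ((Ulim * A * Ulimᴴ) * Cᴴ - Cᴴ * (Ulim * A * Ulimᴴ)) = 0 := by
  have hode' : ∀ t, 0 ≤ t → HasDerivAt U (-(skewGrad A C (U t) * U t)) t := hode
  obtain ⟨hU0', hdet0⟩ := Matrix.mem_specialUnitaryGroup_iff.1 hU0
  have hU0'' : (U 0)ᴴ * U 0 = 1 := Matrix.mem_unitaryGroup_iff'.1 hU0'
  have hmem : ∀ t : ℝ, 0 ≤ t → U t ∈ Matrix.specialUnitaryGroup (Fin N) ℂ := fun t ht =>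
    Matrix.mem_specialUnitaryGroup_iff.2
      ⟨Matrix.mem_unitaryGroup_iff'.2 (conjTranspose_mul_self_of_flow hU0'' hode' ht),
        (det_of_flow hode' ht).trans hdet0⟩
  refine ⟨hmem, ?_, ?_⟩
  · refine monotoneOn_of_hasDerivWithinAt_nonneg (convex_Ici 0)
      (f' := fun t => frobSq (skewGrad A C (U t)))
      (fun t ht => (hasDerivAt_trObj_of_flow hode' ht).continuousAt.continuousWithinAt)
      (fun t ht => (hasDerivAt_trObj_of_flow hode' (interior_subset ht)).hasDerivWithinAt)
      fun t _ => frobSq_nonneg _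
  · obtain ⟨V, hV, hcrit⟩ := exists_tendsto_of_flow hN hU0'' hode'
    have hclosed : IsClosed {V : Matrix (Fin N) (Fin N) ℂ | Vᴴ * V = 1 ∧ V.det = 1} :=
      (isClosed_eq (by fun_prop) continuous_const).inter (isClosed_eq (by fun_prop) continuous_const)
    have hVmem := hclosed.mem_of_tendsto hV (by
      filter_upwards [eventually_ge_atTop 0] with t ht
      obtain ⟨h1, h2⟩ := Matrix.mem_specialUnitaryGroup_iff.1 (hmem t ht)
      exact ⟨Matrix.mem_unitaryGroup_iff'.1 h1, h2⟩)
    exact ⟨V, Matrix.mem_specialUnitaryGroup_iff.2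
      ⟨Matrix.mem_unitaryGroup_iff'.2 hVmem.1, hVmem.2⟩, hV, hcrit⟩
end

section
/- For all complex N×N matrices X and C: the double commutator [X, ([X, C†])_S] vanishes if and only if the skew-Hermitian part ([X, C†])_S itself vanishes. (Thus the equilibria of the double-bracket flow Ẋ = [X, ([X,C†])_S] are exactly the points with ([X,C†])_S = 0.) -/
open Matrix

/-- A commutator `[X, D]` is trace-orthogonal to every matrix commuting with `X`. -/
theorem Matrix.trace_commutator_mul_eq_zero {n R : Type*} [Fintype n] [CommRing R]
    {X S : Matrix n n R} (D : Matrix n n R) (h : X * S = S * X) :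
    ((X * D - D * X) * S).trace = 0 := by
  rw [sub_mul, trace_sub, Matrix.mul_assoc D X S, h, ← Matrix.mul_assoc,
    Matrix.trace_mul_comm (D * S) X, Matrix.mul_assoc, sub_self]

open scoped ComplexOrder in
/-- If `A - Aᴴ` is trace-orthogonal to `A`, then it vanishes. -/
theorem Matrix.sub_conjTranspose_eq_zero_of_trace_mul_eq_zero {n : Type*} [Fintype n]
    {A : Matrix n n ℂ} (h : (A * (A - Aᴴ)).trace = 0) : A - Aᴴ = 0 := by
  have h_skew : (A - Aᴴ)ᴴ = -(A - Aᴴ) := by simp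
  have h_conj : ((A - Aᴴ) * Aᴴ).trace = 0 := by
    have := congrArg star h
    rwa [← trace_conjTranspose, conjTranspose_mul, h_skew, neg_mul, trace_neg, star_zero,
      neg_eq_zero] at this
  rw [← trace_conjTranspose_mul_self_eq_zero_iff, h_skew, neg_mul, trace_neg, neg_eq_zero]
  nth_rewrite 2 [sub_eq_add_neg]
  rw [mul_add, mul_neg, trace_add, trace_neg, h_conj, trace_mul_comm, h, neg_zero, add_zero]

/-- The double commutator `[X, ([X, C†])_S]` vanishes if and only if the skew-Hermitian part
`([X, C†])_S = ([X,C†] − [X,C†]†)/2` vanishes: the equilibria of the double-bracket flow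
`Ẋ = [X, ([X,C†])_S]` are exactly the points with `([X,C†])_S = 0`. -/
theorem stmt5 (N : ℕ) (X C : Matrix (Fin N) (Fin N) ℂ) :
    X * (((1 : ℂ) / 2) • ((X * Cᴴ - Cᴴ * X) - (X * Cᴴ - Cᴴ * X)ᴴ)) -
        (((1 : ℂ) / 2) • ((X * Cᴴ - Cᴴ * X) - (X * Cᴴ - Cᴴ * X)ᴴ)) * X = 0 ↔
      ((1 : ℂ) / 2) • ((X * Cᴴ - Cᴴ * X) - (X * Cᴴ - Cᴴ * X)ᴴ) = 0 := by
  refine ⟨fun h => ?_, fun h => by rw [h, mul_zero, zero_mul, sub_self]⟩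
  rw [mul_smul_comm, smul_mul_assoc, ← smul_sub, smul_eq_zero_iff_right (by norm_num),
    sub_eq_zero] at h
  rw [sub_conjTranspose_eq_zero_of_trace_mul_eq_zero (trace_commutator_mul_eq_zero _ h),
    smul_zero]
end
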